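/- arXiv:1609.03808 — 3 statements merged into one kernel-verified Lean document; each statement's English description precedes it below -/
import Mathlib

section
/- Let (W,S) be a finite Coxeter system of rank n = #S. For every subset J ⊆ S, the following equality of Möbius-number sums holds: Σ_{v ∈ W, D_R(v) = J} μ_σ(e,v) = (−1)^n · Σ μ_β(u,v), where the right-hand sum is over all pairs (u,v) with u ≤_β v, S(v) = S and S(u) = J. (Equivalently, the generating series X_σ = Σ_v μ_σ(e,v) Z_{D_R(v)} and X_β = Σ_{u ≤_β v, S(v)=S} μ_β(u,v) Z_{S(u)} in variables Z indexed by subsets of S satisfy X_σ = (−1)^n X_β.) -/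
open scoped Classical

namespace ShardBHZ

variable {B : Type*} {W : Type*} [Group W] {M : CoxeterMatrix B} (cs : CoxeterSystem M W)

/-- The support `S(w)` of `w`: the set of simple reflections appearing in some
(equivalently, any) reduced word for `w`. -/
def supp (w : W) : Set B := {i | ∃ l : List B, cs.IsReduced l ∧ cs.wordProd l = w ∧ i ∈ l}

/-- The standard parabolic subgroup `W_I` generated by the simple reflections in `I`. -/
def parab (I : Set B) : Subgroup W := Subgroup.closure (cs.simple '' I)

/-- `x` has no right descent in `I`; this characterizes the minimal length coset
representatives `W^I` of `W / W_I`. -/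
def IsMinRep (I : Set B) (x : W) : Prop := ∀ i ∈ I, ¬ cs.IsRightDescent x i

/-- The BHZ order: `u ≤_β v` iff the parabolic component `v_{S(u)}` equals `u`, i.e.
`v = (v * u⁻¹) * u` is the parabolic factorization of `v` with respect to `W_{S(u)}`:
`u ∈ W_{S(u)}`, `v * u⁻¹` has no right descent in `S(u)`, and lengths add. -/
def bhzLE (u v : W) : Prop :=
  u ∈ parab cs (supp cs u) ∧ IsMinRep cs (supp cs u) (v * u⁻¹) ∧
    cs.length v = cs.length (v * u⁻¹) + cs.length u

/-- The set `N(w)` of left inversions of `w`. -/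
def invSet (w : W) : Set W := {t | cs.IsLeftInversion w t}

/-- The subgroup `G(w)` generated by `w * s * w⁻¹` for `s` a right descent of `w`. -/
def descConj (w : W) : Subgroup W :=
  Subgroup.closure {x | ∃ i, cs.IsRightDescent w i ∧ x = w * cs.simple i * w⁻¹}

/-- The shard intersection order: `u ≤_σ v` iff `N(u) ⊆ N(v)` and `G(u) ⊆ G(v)`. -/
def shardLE (u v : W) : Prop := invSet cs u ⊆ invSet cs v ∧ descConj cs u ≤ descConj cs v

/-! ### The simple reflections are pairwise distinct -/

section GeometricRepresentation

variable [Fintype B] (M)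

/-- The linear form on `ℝ^B` attached to the `i`-th row of the Cartan matrix of `M`. -/
noncomputable def corootForm (i : B) : Module.Dual ℝ (B → ℝ) :=
  ∑ j, (-2 * Real.cos (Real.pi / M i j)) • LinearMap.proj j

theorem corootForm_single (i j : B) :
    corootForm M i (Pi.single j 1) = -2 * Real.cos (Real.pi / M i j) := by
  simp [corootForm, Pi.single_apply]

theorem corootForm_single_self (i : B) : corootForm M i (Pi.single i 1) = 2 := by
  simp [corootForm_single]

open Polynomial.Chebyshev in
theorem eval_S_add_eval_S_eq_zero {m : ℕ} (hm : 3 ≤ m) {k : ℤ} (hk : 2 * k + 1 = m) :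
    (S ℝ k).eval (2 * Real.cos (2 * (Real.pi / m))) +
      (S ℝ (k - 1)).eval (2 * Real.cos (2 * (Real.pi / m))) = 0 := by
  have hm' : (3 : ℝ) ≤ m := by exact_mod_cast hm
  have hmk : (m : ℝ) = 2 * k + 1 := by exact_mod_cast hk.symm
  set θ := 2 * (Real.pi / m) with hθ
  have hpos : 0 < Real.sin θ := by
    apply Real.sin_pos_of_pos_of_lt_pi
    · positivity
    · rw [hθ, mul_div_assoc', div_lt_iff₀ (by linarith)]
      nlinarith [Real.pi_pos]
  have h1 := S_two_mul_real_cos θ k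
  have h2 := S_two_mul_real_cos θ (k - 1)
  have h3 : ((k : ℝ) + 1) * θ = 2 * Real.pi - k * θ := by
    rw [hθ]; field_simp; rw [hmk]; ring
  rw [h3, Real.sin_two_pi_sub] at h1
  push_cast at h2
  rw [sub_add_cancel] at h2
  have : ((S ℝ k).eval (2 * Real.cos θ) + (S ℝ (k - 1)).eval (2 * Real.cos θ)) * Real.sin θ = 0 := by
    linarith
  exact (mul_eq_zero.mp this).resolve_right hpos.ne'

open Polynomial.Chebyshev in
theorem eval_S_eq_zero {m : ℕ} (hm : 3 ≤ m) {k : ℤ} (hk : 2 * k = m) :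
    (S ℝ (k - 1)).eval (2 * Real.cos (2 * (Real.pi / m))) = 0 := by
  have hm' : (3 : ℝ) ≤ m := by exact_mod_cast hm
  have hmk : (m : ℝ) = 2 * k := by exact_mod_cast hk.symm
  set θ := 2 * (Real.pi / m) with hθ
  have hpos : 0 < Real.sin θ := by
    apply Real.sin_pos_of_pos_of_lt_pi
    · positivity
    · rw [hθ, mul_div_assoc', div_lt_iff₀ (by linarith)]
      nlinarith [Real.pi_pos]
  have h2 := S_two_mul_real_cos θ (k - 1)
  have h3 : (k : ℝ) * θ = Real.pi := by
    have : (k : ℝ) ≠ 0 := by intro h; rw [h] at hmk; linarith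
    rw [hθ, hmk]; field_simp
  push_cast at h2
  rw [sub_add_cancel, h3, Real.sin_pi] at h2
  exact (mul_eq_zero.mp h2).resolve_right hpos.ne'

theorem isLiftable_reflection :
    M.IsLiftable fun i => Module.reflection (corootForm_single_self M i) := by
  intro i j
  rcases Nat.lt_or_ge (M i j) 3 with hlt | hm
  · have hM : M i j = 0 ∨ M i j = 1 ∨ M i j = 2 := by omega
    rcases hM with h | h | h
    · simp [h]
    · have : i = j := by
        by_contra hij
        exact M.off_diagonal i j hij h
      subst this
      rw [h, pow_one]
      ext1 v
      exact Module.involutive_reflection (corootForm_single_self M i) v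
    · have h' : M j i = 2 := by rw [M.symmetric, h]
      have e1 : corootForm M i (Pi.single j 1) = 0 := by simp [corootForm_single, h]
      have e2 : corootForm M j (Pi.single i 1) = 0 := by simp [corootForm_single, h']
      rw [h, pow_two]
      ext1 v
      simp only [LinearEquiv.mul_apply, Module.reflection_apply, map_sub, map_smul, e1, e2,
        corootForm_single_self, LinearEquiv.coe_one, id_eq]
      module
  · have ht : 2 * Real.cos (2 * (Real.pi / M i j)) =
        corootForm M i (Pi.single j 1) * corootForm M j (Pi.single i 1) - 2 := by
      rw [corootForm_single, corootForm_single, M.symmetric j i, Real.cos_two_mul]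
      ring
    ext1 v
    rw [Module.reflection_mul_reflection_pow_apply _ _ _ v _ ht]
    generalize hmm : M i j = m at *
    rcases Nat.even_or_odd' m with ⟨k, hk | hk⟩
    · have a1 : ((m : ℤ) - 2) / 2 = k - 1 := by omega
      have a2 : ((m : ℤ) - 1) / 2 = k - 1 := by omega
      rw [a1, a2, eval_S_eq_zero hm (k := k) (by omega)]
      simp
    · have a1 : ((m : ℤ) - 2) / 2 = k - 1 := by omega
      have a2 : ((m : ℤ) - 1) / 2 = k := by omega
      have a3 : ((m : ℤ) - 3) / 2 = k - 1 := by omega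
      have a4 : (m : ℤ) / 2 = k := by omega
      rw [a1, a2, a3, a4, eval_S_add_eval_S_eq_zero hm (k := k) (by omega)]
      simp

end GeometricRepresentation

theorem simple_injective [Fintype B] : Function.Injective cs.simple := by
  intro i j hij
  by_contra hne
  have h : Module.reflection (corootForm_single_self M i) =
      Module.reflection (corootForm_single_self M j) := by
    rw [← cs.lift_apply_simple (isLiftable_reflection M) i, hij,
      cs.lift_apply_simple (isLiftable_reflection M) j]
  have h2 := congrFun (LinearEquiv.congr_fun h (Pi.single i 1)) i
  simp [Module.reflection_apply, hne] at h2
  norm_num at h2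

/-! ### Inversion sets -/

section InversionCocycle

/-- The action of a simple reflection on `W × ℤ/2` recording the parity of crossings. -/
noncomputable def crossing (i : B) : Function.End (W × ZMod 2) := fun p =>
  (cs.simple i * p.1 * cs.simple i, p.2 + if p.1 = cs.simple i then 1 else 0)

theorem end_mul_apply {α : Type*} (f g : Function.End α) (a : α) : (f * g) a = f (g a) := rfl

theorem end_one_apply {α : Type*} (a : α) : (1 : Function.End α) a = a := rfl

theorem isLiftable_crossing : M.IsLiftable (crossing cs) := by
  intro i j
  set c := cs.simple i * cs.simple j with hc
  have hcm : c ^ M i j = 1 := cs.simple_mul_simple_pow i j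
  have hjc : ∀ k : ℕ, cs.simple j * c ^ k = (c ^ k)⁻¹ * cs.simple j := by
    intro k
    have h : SemiconjBy (cs.simple j) c c⁻¹ := by
      simp [SemiconjBy, hc, mul_assoc]
    rw [← inv_pow]
    exact h.pow_right k
  have hpow : ∀ l k : ℕ, cs.simple j * c ^ (l + 2 * k) =
      (c ^ k)⁻¹ * (cs.simple j * c ^ l) * c ^ k := by
    intro l k
    rw [← mul_assoc, ← hjc, mul_assoc, mul_assoc, ← pow_add, ← pow_add]
    congr 2
    ring
  have key : ∀ (k : ℕ) (t : W) (ε : ZMod 2), ((crossing cs i * crossing cs j) ^ k) (t, ε) =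
      (c ^ k * t * (c ^ k)⁻¹,
        ε + ∑ l ∈ Finset.range (2 * k), if t = cs.simple j * c ^ l then 1 else 0) := by
    intro k
    induction k with
    | zero => intro t ε; simp [end_one_apply]
    | succ k ih =>
      intro t ε
      have h1 : (c ^ k * t * (c ^ k)⁻¹ = cs.simple j) ↔ t = cs.simple j * c ^ (2 * k) := by
        have := hpow 0 k
        rw [zero_add] at this
        rw [this]
        constructor
        · intro h; rw [← h]; group
        · intro h; rw [h]; group
      have h2 : (cs.simple j * (c ^ k * t * (c ^ k)⁻¹) * cs.simple j = cs.simple i) ↔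
          t = cs.simple j * c ^ (2 * k + 1) := by
        have hsc : cs.simple j * c ^ (2 * k + 1) =
            (c ^ k)⁻¹ * (cs.simple j * cs.simple i * cs.simple j) * c ^ k := by
          rw [add_comm, hpow 1 k, pow_one, hc, ← mul_assoc (cs.simple j)]
        rw [hsc]
        generalize c ^ k = d
        constructor
        · intro h; rw [← h]; simp [mul_assoc]
        · intro h; rw [h]; simp [mul_assoc]
      rw [pow_succ', end_mul_apply, ih, end_mul_apply]
      simp only [crossing, h1, h2]
      rw [mul_add, mul_one, Finset.sum_range_succ, Finset.sum_range_succ]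
      refine Prod.ext ?_ ?_
      · simp [pow_succ', hc, mul_assoc]
      · simp only [add_assoc]
  funext ⟨t, ε⟩
  rw [key, hcm, two_mul, Finset.sum_range_add]
  have : ∀ l, c ^ (M i j + l) = c ^ l := fun l => by rw [pow_add, hcm, one_mul]
  simp only [this]
  rw [CharTwo.add_self_eq_zero]
  simp [end_one_apply]

/-- The parity of the number of times the reflection `t` occurs in the left inversion sequence
of a word for `w`. -/
noncomputable def crossingParity (w t : W) : ZMod 2 :=
  (cs.lift ⟨crossing cs, isLiftable_crossing cs⟩ w⁻¹ (t, 0)).2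

theorem lift_crossing_apply (w t : W) (ε : ZMod 2) :
    cs.lift ⟨crossing cs, isLiftable_crossing cs⟩ w (t, ε) =
      (w * t * w⁻¹, ε + crossingParity cs w⁻¹ t) := by
  suffices h : ∀ t ε, (cs.lift ⟨crossing cs, isLiftable_crossing cs⟩ w (t, ε)).1 = w * t * w⁻¹ ∧
      (cs.lift ⟨crossing cs, isLiftable_crossing cs⟩ w (t, ε)).2 =
        ε + (cs.lift ⟨crossing cs, isLiftable_crossing cs⟩ w (t, 0)).2 by
    refine Prod.ext (h t ε).1 ?_
    rw [crossingParity, inv_inv]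
    exact (h t ε).2
  induction w using cs.simple_induction_left with
  | one =>
    intro t ε
    simp [end_one_apply]
  | mul_simple_left w i ih =>
    intro t ε
    rw [map_mul, cs.lift_apply_simple, end_mul_apply, end_mul_apply]
    simp only [crossing, (ih _ _).1]
    refine ⟨by simp [mul_assoc], ?_⟩
    rw [(ih t ε).2]
    ring

theorem crossingParity_mul (x y t : W) :
    crossingParity cs (x * y) t = crossingParity cs x t + crossingParity cs y (x⁻¹ * t * x) := by
  rw [crossingParity, mul_inv_rev, map_mul, end_mul_apply,
    lift_crossing_apply, lift_crossing_apply]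
  simp

theorem crossingParity_one (t : W) : crossingParity cs 1 t = 0 := by
  simp [crossingParity, end_one_apply]

theorem crossingParity_simple (i : B) (t : W) :
    crossingParity cs (cs.simple i) t = if t = cs.simple i then 1 else 0 := by
  simp [crossingParity, cs.lift_apply_simple, crossing]

theorem crossingParity_wordProd (l : List B) (t : W) :
    crossingParity cs (cs.wordProd l) t = ((cs.leftInvSeq l).count t : ZMod 2) := by
  induction l generalizing t with
  | nil => simp [crossingParity_one]
  | cons i l ih =>
    have h : List.count t (List.map (MulAut.conj (cs.simple i)) (cs.leftInvSeq l)) =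
        List.count (cs.simple i * t * cs.simple i) (cs.leftInvSeq l) := by
      have := List.count_map_of_injective (cs.leftInvSeq l) _
        (MulAut.conj (cs.simple i)).injective (cs.simple i * t * cs.simple i)
      rw [← this]
      congr 1
      simp [mul_assoc]
    rw [cs.wordProd_cons, crossingParity_mul, crossingParity_simple, ih, CoxeterSystem.leftInvSeq,
      List.count_cons, h, cs.inv_simple]
    push_cast
    rw [add_comm]
    congr 1
    by_cases ht : t = cs.simple i
    · simp [ht]
    · simp [ht, Ne.symm ht]

theorem crossingParity_self {t : W} (ht : cs.IsReflection t) : crossingParity cs t t = 1 := by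
  obtain ⟨w, i, rfl⟩ := ht
  have h := crossingParity_mul cs w w⁻¹ (w * cs.simple i * w⁻¹)
  rw [mul_inv_cancel, crossingParity_one] at h
  rw [crossingParity_mul, crossingParity_mul, crossingParity_simple]
  simp only [mul_inv_rev, mul_assoc, inv_mul_cancel_left, inv_mul_cancel, mul_one,
    cs.inv_simple, cs.simple_mul_simple_self, if_true] at h ⊢
  rw [add_right_comm, ← h, zero_add]

theorem mem_invSet_of_crossingParity {w t : W} (h : crossingParity cs w t = 1) :
    t ∈ invSet cs w := by
  obtain ⟨l, hl, rfl⟩ := cs.exists_isReduced w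
  apply cs.isLeftInversion_of_mem_leftInvSeq hl
  rw [crossingParity_wordProd] at h
  by_contra hn
  rw [List.count_eq_zero_of_not_mem hn] at h
  simp at h

theorem mem_invSet_iff_crossingParity {w t : W} :
    t ∈ invSet cs w ↔ crossingParity cs w t = 1 := by
  refine ⟨fun h => ?_, mem_invSet_of_crossingParity cs⟩
  by_contra hn
  have h0 : crossingParity cs w t = 0 := by
    generalize crossingParity cs w t = z at hn
    revert hn; revert z; decide
  have h1 : crossingParity cs (t * w) t = 1 := by
    rw [crossingParity_mul, crossingParity_self cs h.1]
    have : t⁻¹ * t * t = t := by simp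
    rw [this, h0, add_zero]
  have h2 : cs.IsLeftInversion (t * w) t := mem_invSet_of_crossingParity cs h1
  exact h.1.isLeftInversion_mul_right_iff.mp h2 h

end InversionCocycle

theorem mem_invSet_mul {x y t : W} :
    t ∈ invSet cs (x * y) ↔ ¬ (t ∈ invSet cs x ↔ x⁻¹ * t * x ∈ invSet cs y) := by
  simp only [mem_invSet_iff_crossingParity, crossingParity_mul]
  generalize crossingParity cs x t = a
  generalize crossingParity cs y (x⁻¹ * t * x) = b
  revert a b
  decide

theorem isReflection_of_mem_invSet {w t : W} (h : t ∈ invSet cs w) : cs.IsReflection t := h.1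

theorem invSet_wordProd_subset (l : List B) {t : W} (h : t ∈ invSet cs (cs.wordProd l)) :
    t ∈ cs.leftInvSeq l := by
  rw [mem_invSet_iff_crossingParity, crossingParity_wordProd] at h
  by_contra hn
  rw [List.count_eq_zero_of_not_mem hn] at h
  simp at h

theorem invSet_wordProd_eq {l : List B} (hl : cs.IsReduced l) :
    invSet cs (cs.wordProd l) = {t | t ∈ cs.leftInvSeq l} :=
  Set.ext fun _ => ⟨invSet_wordProd_subset cs l, cs.isLeftInversion_of_mem_leftInvSeq hl⟩

theorem ncard_invSet (w : W) : (invSet cs w).ncard = cs.length w := by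
  obtain ⟨l, hl, rfl⟩ := cs.exists_isReduced w
  have : {t | t ∈ cs.leftInvSeq l} = ((cs.leftInvSeq l).toFinset : Set W) := by
    ext; simp
  rw [invSet_wordProd_eq cs hl, this, Set.ncard_coe_finset,
    List.toFinset_card_of_nodup (CoxeterSystem.IsReduced.nodup_leftInvSeq cs hl), cs.length_leftInvSeq, hl]

theorem invSet_one : invSet cs 1 = ∅ := by
  ext t
  simp [invSet, CoxeterSystem.IsLeftInversion]

theorem invSet_simple (i : B) : invSet cs (cs.simple i) = {cs.simple i} := by
  ext t
  simp [mem_invSet_iff_crossingParity, crossingParity_simple]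

theorem mem_invSet_inv {w t : W} : t ∈ invSet cs w⁻¹ ↔ w * t * w⁻¹ ∈ invSet cs w := by
  have h := mem_invSet_mul cs (x := w) (y := w⁻¹) (t := w * t * w⁻¹)
  rw [mul_inv_cancel, invSet_one, show w⁻¹ * (w * t * w⁻¹) * w = t by group] at h
  have h' : ¬ w * t * w⁻¹ ∈ (∅ : Set W) := Set.notMem_empty _
  tauto

theorem isRightDescent_iff_mem {w : W} {i : B} :
    cs.IsRightDescent w i ↔ w * cs.simple i * w⁻¹ ∈ invSet cs w := by
  rw [← mem_invSet_inv, invSet, Set.mem_ofPred_eq, cs.isLeftInversion_inv_iff,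
    cs.isRightInversion_simple_iff_isRightDescent]

theorem mem_invSet_mul_simple {w t : W} {i : B} (h : cs.IsRightDescent w i) :
    t ∈ invSet cs (w * cs.simple i) ↔ t ∈ invSet cs w ∧ t ≠ w * cs.simple i * w⁻¹ := by
  have hi := (isRightDescent_iff_mem cs).mp h
  rw [mem_invSet_mul, invSet_simple, Set.mem_singleton_iff]
  have : w⁻¹ * t * w = cs.simple i ↔ t = w * cs.simple i * w⁻¹ := by
    constructor
    · intro h; rw [← h]; group
    · intro h; rw [h]; group
  rw [this]
  by_cases ht : t = w * cs.simple i * w⁻¹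
  · subst ht; tauto
  · tauto

/-! ### The weak order -/

theorem exists_isRightDescent_of_invSet_subset {w u : W} (h : invSet cs w ⊆ invSet cs u)
    (hne : w ≠ u) : ∃ i, cs.IsRightDescent u i ∧ u * cs.simple i * u⁻¹ ∉ invSet cs w := by
  obtain ⟨q, rfl⟩ : ∃ q, u = w * q := ⟨w⁻¹ * u, by group⟩
  have hq : q ≠ 1 := by rintro rfl; simp at hne
  obtain ⟨i, hi⟩ := cs.exists_rightDescent_of_ne_one hq
  have h1 := (isRightDescent_iff_mem cs).mp hi
  have h2 := mem_invSet_mul cs (x := w) (y := q) (t := w * q * cs.simple i * (w * q)⁻¹)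
  rw [show w⁻¹ * (w * q * cs.simple i * (w * q)⁻¹) * w = q * cs.simple i * q⁻¹ by group] at h2
  refine ⟨i, ?_, ?_⟩
  · rw [isRightDescent_iff_mem]
    have := @h (w * q * cs.simple i * (w * q)⁻¹)
    tauto
  · have := @h (w * q * cs.simple i * (w * q)⁻¹)
    tauto

theorem invSet_injective : Function.Injective (invSet cs) := by
  intro w u h
  by_contra hne
  obtain ⟨i, hi, hi'⟩ := exists_isRightDescent_of_invSet_subset cs h.subset hne
  exact hi' (h ▸ (isRightDescent_iff_mem cs).mp hi)

theorem length_lt_of_invSet_subset [Finite W] {w u : W} (h : invSet cs w ⊆ invSet cs u)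
    (hne : w ≠ u) : cs.length w < cs.length u := by
  rw [← ncard_invSet, ← ncard_invSet]
  exact Set.ncard_lt_ncard (h.ssubset_of_ne fun h' => hne (invSet_injective cs h'))

/-! ### Parabolic subgroups -/

theorem simple_mem_parab {I : Set B} {i : B} (hi : i ∈ I) : cs.simple i ∈ parab cs I :=
  Subgroup.subset_closure ⟨i, hi, rfl⟩

theorem parab_mono {I K : Set B} (h : I ⊆ K) : parab cs I ≤ parab cs K :=
  Subgroup.closure_mono (Set.image_mono h)

theorem wordProd_mem_parab {I : Set B} {l : List B} (hl : ∀ i ∈ l, i ∈ I) :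
    cs.wordProd l ∈ parab cs I := by
  induction l with
  | nil => simp
  | cons i l ih =>
    rw [cs.wordProd_cons]
    exact mul_mem (simple_mem_parab cs (hl i (by simp))) (ih fun j hj => hl j (by simp [hj]))

theorem exists_word_of_mem_parab {I : Set B} {p : W} (hp : p ∈ parab cs I) :
    ∃ l : List B, (∀ i ∈ l, i ∈ I) ∧ cs.wordProd l = p := by
  induction hp using Subgroup.closure_induction with
  | mem x hx =>
    obtain ⟨i, hi, rfl⟩ := hx
    exact ⟨[i], by simpa using hi, by simp⟩
  | one => exact ⟨[], by simp, by simp⟩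
  | mul x y _ _ hx hy =>
    obtain ⟨l, hl, rfl⟩ := hx
    obtain ⟨l', hl', rfl⟩ := hy
    refine ⟨l ++ l', fun i hi => ?_, cs.wordProd_append l l'⟩
    rcases List.mem_append.mp hi with h | h
    · exact hl i h
    · exact hl' i h
  | inv x _ hx =>
    obtain ⟨l, hl, rfl⟩ := hx
    exact ⟨l.reverse, by simpa using hl, by simp⟩

theorem invSet_subset_parab {I : Set B} {p : W} (hp : p ∈ parab cs I) :
    invSet cs p ⊆ parab cs I := by
  induction hp using Subgroup.closure_induction with
  | mem x hx =>
    obtain ⟨i, hi, rfl⟩ := hx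
    rw [invSet_simple]
    simpa using simple_mem_parab cs hi
  | one => simp [invSet_one]
  | mul x y hx' _ hx hy =>
    intro t ht
    rw [mem_invSet_mul] at ht
    by_cases h : t ∈ invSet cs x
    · exact hx h
    · have h' : x⁻¹ * t * x ∈ invSet cs y := by tauto
      have := mul_mem (mul_mem hx' (hy h')) (inv_mem hx')
      rwa [show x * (x⁻¹ * t * x) * x⁻¹ = t by group] at this
  | inv x hx' hx =>
    intro t ht
    rw [mem_invSet_inv] at ht
    have := mul_mem (mul_mem (inv_mem hx') (hx ht)) hx'
    rwa [show x⁻¹ * (x * t * x⁻¹) * x = t by group] at this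

theorem exists_isRightDescent_of_mem_parab {I : Set B} {p : W} (hp : p ∈ parab cs I)
    (hne : p ≠ 1) : ∃ i ∈ I, cs.IsRightDescent p i := by
  obtain ⟨l, hl, rfl⟩ := exists_word_of_mem_parab cs hp
  clear hp
  induction hn : l.length using Nat.strong_induction_on generalizing l with
  | _ n ih =>
    rcases List.eq_nil_or_concat l with rfl | ⟨l', i, rfl⟩
    · simp at hne
    by_cases hi : cs.IsRightDescent (cs.wordProd (l'.concat i)) i
    · exact ⟨i, hl i (by simp), hi⟩
    rw [cs.isRightDescent_iff_not_isRightDescent_mul, not_not, cs.wordProd_concat,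
      cs.simple_mul_simple_cancel_right, isRightDescent_iff_mem] at hi
    have hmem := invSet_wordProd_subset cs l' hi
    obtain ⟨j, hj, hj'⟩ := List.getElem_of_mem hmem
    have hprod : cs.wordProd (l'.eraseIdx j) = cs.wordProd (l'.concat i) := by
      rw [← cs.getD_leftInvSeq_mul_wordProd, List.getD_eq_getElem _ _ hj, hj', cs.wordProd_concat]
      group
    rw [← hprod] at hne ⊢
    rw [cs.length_leftInvSeq] at hj
    refine ih _ ?_ (l'.eraseIdx j) (fun k hk => hl k ?_) hne rfl
    · rw [← hn, List.length_eraseIdx_of_lt hj, List.length_concat]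
      omega
    · simpa using Or.inl (List.mem_of_mem_eraseIdx hk)

theorem simple_mem_parab_iff [Fintype B] {I : Set B} {j : B} :
    cs.simple j ∈ parab cs I ↔ j ∈ I := by
  refine ⟨fun h => ?_, simple_mem_parab cs⟩
  have hne : cs.simple j ≠ 1 := by
    intro h1
    have := cs.length_simple j
    rw [h1, cs.length_one] at this
    omega
  obtain ⟨i, hi, hd⟩ := exists_isRightDescent_of_mem_parab cs h hne
  rw [CoxeterSystem.IsRightDescent, cs.length_simple, Nat.lt_one_iff, cs.length_eq_zero_iff] at hd
  have : cs.simple j = cs.simple i := by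
    rw [← cs.inv_simple i]; exact eq_inv_of_mul_eq_one_left hd
  rwa [simple_injective cs this]

theorem mem_of_isRightDescent_of_mem_parab [Fintype B] {I : Set B} {p : W} {j : B}
    (hp : p ∈ parab cs I) (hj : cs.IsRightDescent p j) : j ∈ I := by
  rw [← simple_mem_parab_iff cs]
  have h := invSet_subset_parab cs hp ((isRightDescent_iff_mem cs).mp hj)
  have := mul_mem (mul_mem (inv_mem hp) h) hp
  rwa [show p⁻¹ * (p * cs.simple j * p⁻¹) * p = cs.simple j by group] at this

theorem exists_isMinRep (I : Set B) (w : W) :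
    ∃ m p, IsMinRep cs I m ∧ p ∈ parab cs I ∧ w = m * p := by
  induction hn : cs.length w using Nat.strong_induction_on generalizing w with
  | _ n ih =>
    by_cases hw : IsMinRep cs I w
    · exact ⟨w, 1, hw, one_mem _, by simp⟩
    rw [IsMinRep] at hw
    push Not at hw
    obtain ⟨i, hi, hd⟩ := hw
    obtain ⟨m, p, hm, hp, he⟩ := ih _ (hn ▸ hd) (w * cs.simple i) rfl
    refine ⟨m, p * cs.simple i, hm, mul_mem hp (simple_mem_parab cs hi), ?_⟩
    rw [← mul_assoc, ← he, cs.simple_mul_simple_cancel_right]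

theorem IsMinRep.conj_notMem_invSet {I : Set B} {m r : W} (hm : IsMinRep cs I m)
    (hr : r ∈ parab cs I) : m * r * m⁻¹ ∉ invSet cs m := by
  obtain ⟨q, hq, hmin⟩ : ∃ q ∈ parab cs I, ∀ q' ∈ parab cs I,
      cs.length (m * q) ≤ cs.length (m * q') := by
    have hne : (parab cs I : Set W).Nonempty := ⟨1, one_mem _⟩
    exact ⟨Function.argminOn (fun q => cs.length (m * q)) _ hne, Function.argminOn_mem _ _ _,
      fun q' hq' => Function.argminOn_le (fun q => cs.length (m * q)) _ hq'⟩
  have hred : ∀ r ∈ parab cs I, (m * q) * r * (m * q)⁻¹ ∉ invSet cs (m * q) := by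
    intro r hr h
    have h2 := h.2
    rw [inv_mul_cancel_right, mul_assoc] at h2
    exact absurd h2 (not_lt.mpr (hmin _ (mul_mem hq hr)))
  by_cases h1 : q⁻¹ = 1
  · rw [inv_eq_one] at h1
    simpa [h1] using hred r hr
  · obtain ⟨i, hi, hd⟩ := exists_isRightDescent_of_mem_parab cs (inv_mem hq) h1
    exfalso
    apply hm i hi
    rw [isRightDescent_iff_mem] at hd ⊢
    have h2 := mem_invSet_mul cs (x := m * q) (y := q⁻¹) (t := m * cs.simple i * m⁻¹)
    rw [mul_inv_cancel_right, show (m * q)⁻¹ * (m * cs.simple i * m⁻¹) * (m * q) =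
      q⁻¹ * cs.simple i * q⁻¹⁻¹ by group] at h2
    have h3 := hred _ (invSet_subset_parab cs (inv_mem hq) hd)
    rw [show m * q * (q⁻¹ * cs.simple i * q⁻¹⁻¹) * (m * q)⁻¹ = m * cs.simple i * m⁻¹ by group] at h3
    tauto

theorem IsMinRep.conj_mem_invSet_mul_iff {I : Set B} {m p r : W} (hm : IsMinRep cs I m)
    (hr : r ∈ parab cs I) : m * r * m⁻¹ ∈ invSet cs (m * p) ↔ r ∈ invSet cs p := by
  rw [mem_invSet_mul, show m⁻¹ * (m * r * m⁻¹) * m = r by group]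
  have := hm.conj_notMem_invSet cs hr
  tauto

theorem IsMinRep.mem_invSet_mul_iff {I : Set B} {m p t : W} (hm : IsMinRep cs I m)
    (hp : p ∈ parab cs I) :
    t ∈ invSet cs (m * p) ↔ t ∈ invSet cs m ∨ m⁻¹ * t * m ∈ invSet cs p := by
  rw [mem_invSet_mul]
  have h : m⁻¹ * t * m ∈ invSet cs p → t ∉ invSet cs m := by
    intro h
    have := hm.conj_notMem_invSet cs (invSet_subset_parab cs hp h)
    rwa [show m * (m⁻¹ * t * m) * m⁻¹ = t by group] at this
  tauto

theorem IsMinRep.isRightDescent_mul_iff {I : Set B} {m p : W} {i : B} (hm : IsMinRep cs I m)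
    (hp : p ∈ parab cs I) (hi : i ∈ I) :
    cs.IsRightDescent (m * p) i ↔ cs.IsRightDescent p i := by
  rw [isRightDescent_iff_mem, isRightDescent_iff_mem, ← hm.conj_mem_invSet_mul_iff cs
    (mul_mem (mul_mem hp (simple_mem_parab cs hi)) (inv_mem hp))]
  rw [show m * (p * cs.simple i * p⁻¹) * m⁻¹ = m * p * cs.simple i * (m * p)⁻¹ by group]

theorem IsMinRep.length_mul {I : Set B} {m p : W} (hm : IsMinRep cs I m)
    (hp : p ∈ parab cs I) : cs.length (m * p) = cs.length m + cs.length p := by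
  induction hn : cs.length p using Nat.strong_induction_on generalizing p with
  | _ n ih =>
    subst hn
    by_cases h1 : p = 1
    · simp [h1]
    obtain ⟨i, hi, hd⟩ := exists_isRightDescent_of_mem_parab cs hp h1
    have h2 := (hm.isRightDescent_mul_iff cs hp hi).mpr hd
    have h3 := ih _ hd (mul_mem hp (simple_mem_parab cs hi)) rfl
    rw [cs.isRightDescent_iff] at hd h2
    rw [← mul_assoc] at h3
    omega

theorem IsMinRep.eq_of_mul_eq {I : Set B} {m p m' p' : W} (hm : IsMinRep cs I m)
    (hm' : IsMinRep cs I m') (hp : p ∈ parab cs I) (hp' : p' ∈ parab cs I)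
    (h : m * p = m' * p') : m = m' ∧ p = p' := by
  have hq : p * p'⁻¹ = 1 := by
    by_contra hne
    have hmem := mul_mem hp (inv_mem hp')
    obtain ⟨i, hi, hd⟩ := exists_isRightDescent_of_mem_parab cs hmem hne
    apply hm' i hi
    rw [← hm.isRightDescent_mul_iff cs hmem hi, ← mul_assoc, h, mul_inv_cancel_right] at hd
    exact hd
  have hpp : p = p' := mul_inv_eq_one.mp hq
  subst hpp
  exact ⟨mul_right_cancel h, rfl⟩

theorem exists_parab_longest [Finite W] (I : Set B) : ∃ p ∈ parab cs I,
    ∀ r ∈ parab cs I, cs.IsReflection r → r ∈ invSet cs p := by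
  obtain ⟨p, hp, hmax⟩ := Set.exists_max_image (parab cs I : Set W) cs.length (Set.toFinite _)
    ⟨1, one_mem _⟩
  exact ⟨p, hp, fun r hr hrefl => ⟨hrefl, lt_of_le_of_ne (hmax _ (mul_mem hr hp))
    (hrefl.length_mul_right_ne p)⟩⟩

theorem mem_invSet_of_forall_isRightDescent [Finite W] {I : Set B} {p : W} (hp : p ∈ parab cs I)
    (hd : ∀ i ∈ I, cs.IsRightDescent p i) {r : W} (hr : r ∈ parab cs I)
    (hrefl : cs.IsReflection r) : r ∈ invSet cs p := by
  obtain ⟨p₁, hp₁, hall⟩ := exists_parab_longest cs I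
  have hq : p₁⁻¹ * p = 1 := by
    by_contra hne
    have hmem := mul_mem (inv_mem hp₁) hp
    obtain ⟨i, hi, hdi⟩ := exists_isRightDescent_of_mem_parab cs hmem hne
    have h1 := hd i hi
    rw [isRightDescent_iff_mem] at h1 hdi
    have h2 := mem_invSet_mul cs (x := p₁) (y := p₁⁻¹ * p) (t := p * cs.simple i * p⁻¹)
    rw [mul_inv_cancel_left, show p₁⁻¹ * (p * cs.simple i * p⁻¹) * p₁ =
      p₁⁻¹ * p * cs.simple i * (p₁⁻¹ * p)⁻¹ by group] at h2
    have h3 := hall _ (mul_mem (mul_mem hp (simple_mem_parab cs hi)) (inv_mem hp))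
      ((cs.isReflection_simple i).conj p)
    tauto
  rw [inv_mul_eq_one] at hq
  exact hq ▸ hall r hr hrefl

theorem conj_mem_invSet_of_forall_isRightDescent [Finite W] {I : Set B} {w : W}
    (hd : ∀ i ∈ I, cs.IsRightDescent w i) {r : W} (hr : r ∈ parab cs I)
    (hrefl : cs.IsReflection r) : w * r * w⁻¹ ∈ invSet cs w := by
  obtain ⟨m, p, hm, hp, rfl⟩ := exists_isMinRep cs I w
  have hmem := mul_mem (mul_mem hp hr) (inv_mem hp)
  have h := mem_invSet_of_forall_isRightDescent cs hp
    (fun i hi => (hm.isRightDescent_mul_iff cs hp hi).mp (hd i hi)) hmem (hrefl.conj p)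
  rw [← hm.conj_mem_invSet_mul_iff cs hmem] at h
  rwa [show m * (p * r * p⁻¹) * m⁻¹ = m * p * r * (m * p)⁻¹ by group] at h

/-! ### Fibres of the inversion sets below `a * x` -/

/-- The elements `w` with `N(w) ⊆ N(a * x)` whose inversion set agrees with that of `a * x` on the
conjugate `a * W_D * a⁻¹`. -/
def InFib (a : W) (D : Set B) (x w : W) : Prop :=
  invSet cs w ⊆ invSet cs (a * x) ∧
    ∀ t ∈ invSet cs (a * x), a⁻¹ * t * a ∈ parab cs D → t ∈ invSet cs w

/-- All the right descents of `w` give reflections in `a * W_D * a⁻¹`. -/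
def IsFibMin (a : W) (D : Set B) (w : W) : Prop :=
  ∀ i, cs.IsRightDescent w i → a⁻¹ * (w * cs.simple i * w⁻¹) * a ∈ parab cs D

theorem exists_parab_conj_mem_iff [Finite W] (a : W) {I : Set B} {u : W}
    (hd : ∀ i ∈ I, cs.IsRightDescent u i) : ∃ k ∈ parab cs I, ∀ r ∈ parab cs I,
      cs.IsReflection r → (u * r * u⁻¹ ∈ invSet cs a ↔ r ∉ invSet cs k) := by
  obtain ⟨z, q, hz, hq, hy⟩ := exists_isMinRep cs I (a⁻¹ * u)
  refine ⟨q⁻¹, inv_mem hq, fun r hr hrefl => ?_⟩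
  have h := mem_invSet_mul cs (x := u) (y := (z * q)⁻¹) (t := u * r * u⁻¹)
  have h1 := conj_mem_invSet_of_forall_isRightDescent cs hd hr hrefl
  rw [show u * (z * q)⁻¹ = a by rw [← hy]; group, show u⁻¹ * (u * r * u⁻¹) * u = r by group,
    mem_invSet_inv, show z * q * r * (z * q)⁻¹ = z * (q * r * q⁻¹) * z⁻¹ by group,
    hz.conj_mem_invSet_mul_iff cs (mul_mem (mul_mem hq hr) (inv_mem hq)), ← mem_invSet_inv cs (w := q)] at h
  tauto

theorem conj_mem_invSet_of_forall_simple [Finite W] {a : W} {I : Set B} {u : W}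
    (hd : ∀ i ∈ I, cs.IsRightDescent u i)
    (ha : ∀ i ∈ I, u * cs.simple i * u⁻¹ ∈ invSet cs a) {r : W} (hr : r ∈ parab cs I)
    (hrefl : cs.IsReflection r) : u * r * u⁻¹ ∈ invSet cs a := by
  obtain ⟨k, hk, h⟩ := exists_parab_conj_mem_iff cs a hd
  have hk1 : k⁻¹ = 1 := by
    by_contra hne
    obtain ⟨i, hi, hdi⟩ := exists_isRightDescent_of_mem_parab cs (inv_mem hk) hne
    rw [isRightDescent_iff_mem, ← mem_invSet_inv, inv_inv] at hdi
    exact (h _ (simple_mem_parab cs hi) (cs.isReflection_simple i)).mp (ha i hi) hdi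
  rw [h r hr hrefl, inv_eq_one.mp hk1, invSet_one]
  exact Set.notMem_empty _

section Fibre

variable {cs} {a x : W} {D : Set B}

theorem notMem_invSet_of_conj_mem (ha : IsMinRep cs D a) {t : W}
    (ht : a⁻¹ * t * a ∈ parab cs D) : t ∉ invSet cs a := by
  have := ha.conj_notMem_invSet cs ht
  rwa [show a * (a⁻¹ * t * a) * a⁻¹ = t by group] at this

theorem mem_invSet_iff_conj_notMem (ha : IsMinRep cs D a) (hx : x ∈ parab cs D) {t : W}
    (ht : t ∈ invSet cs (a * x)) : t ∈ invSet cs a ↔ a⁻¹ * t * a ∉ parab cs D := by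
  refine ⟨fun h h' => notMem_invSet_of_conj_mem ha h' h, fun h => ?_⟩
  rcases (ha.mem_invSet_mul_iff cs hx).mp ht with h' | h'
  · exact h'
  · exact absurd (invSet_subset_parab cs hx h') h

theorem inFib_self : InFib cs a D x (a * x) := ⟨subset_rfl, fun _ h _ => h⟩

theorem InFib.mul_simple {u : W} (hu : InFib cs a D x u) {i : B} (hi : cs.IsRightDescent u i)
    (hG : a⁻¹ * (u * cs.simple i * u⁻¹) * a ∉ parab cs D) :
    InFib cs a D x (u * cs.simple i) := by
  refine ⟨fun t ht => hu.1 ((mem_invSet_mul_simple cs hi).mp ht).1, fun t ht htG => ?_⟩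
  rw [mem_invSet_mul_simple cs hi]
  exact ⟨hu.2 t ht htG, by rintro rfl; exact hG htG⟩

theorem invSet_mul_simple_subset {u : W} {i : B} (hi : cs.IsRightDescent u i) :
    invSet cs (u * cs.simple i) ⊆ invSet cs u :=
  fun _ ht => ((mem_invSet_mul_simple cs hi).mp ht).1

theorem length_mul_simple_lt {u : W} {i : B} (hi : cs.IsRightDescent u i) :
    cs.length (u * cs.simple i) < cs.length u := hi

theorem exists_isFibMin {u : W} (hu : InFib cs a D x u) :
    ∃ w, InFib cs a D x w ∧ IsFibMin cs a D w ∧ invSet cs w ⊆ invSet cs u := by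
  induction hn : cs.length u using Nat.strong_induction_on generalizing u with
  | _ n ih =>
    subst hn
    by_cases h : IsFibMin cs a D u
    · exact ⟨u, hu, h, subset_rfl⟩
    rw [IsFibMin] at h
    push Not at h
    obtain ⟨i, hi, hG⟩ := h
    obtain ⟨w, hw, hw', hs⟩ := ih _ (length_mul_simple_lt hi) (hu.mul_simple hi hG) rfl
    exact ⟨w, hw, hw', hs.trans (invSet_mul_simple_subset hi)⟩

theorem InFib.confluence [Finite W] (ha : IsMinRep cs D a) (hx : x ∈ parab cs D) {u : W}
    (hu : InFib cs a D x u) {i j : B} (hi : cs.IsRightDescent u i) (hj : cs.IsRightDescent u j)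
    (hiG : a⁻¹ * (u * cs.simple i * u⁻¹) * a ∉ parab cs D)
    (hjG : a⁻¹ * (u * cs.simple j * u⁻¹) * a ∉ parab cs D) :
    ∃ m, InFib cs a D x m ∧ invSet cs m ⊆ invSet cs (u * cs.simple i) ∧
      invSet cs m ⊆ invSet cs (u * cs.simple j) := by
  obtain ⟨m, p, hm, hp, hup⟩ := exists_isMinRep cs {i, j} u
  have hd : ∀ k ∈ ({i, j} : Set B), cs.IsRightDescent u k := by
    rintro k (rfl | rfl)
    exacts [hi, hj]
  have hN : ∀ k ∈ ({i, j} : Set B), u * cs.simple k * u⁻¹ ∈ invSet cs a := by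
    rintro k (rfl | rfl)
    · exact (mem_invSet_iff_conj_notMem ha hx
        (hu.1 ((isRightDescent_iff_mem cs).mp hi))).mpr hiG
    · exact (mem_invSet_iff_conj_notMem ha hx
        (hu.1 ((isRightDescent_iff_mem cs).mp hj))).mpr hjG
  have hmu : invSet cs m ⊆ invSet cs u := fun t ht => by
    rw [hup, hm.mem_invSet_mul_iff cs hp]
    exact Or.inl ht
  have key : ∀ k ∈ ({i, j} : Set B), invSet cs m ⊆ invSet cs (u * cs.simple k) := by
    intro k hk t ht
    rw [mem_invSet_mul_simple cs (hd k hk)]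
    refine ⟨hmu ht, ?_⟩
    rintro rfl
    refine hm.conj_notMem_invSet cs
      (mul_mem (mul_mem hp (simple_mem_parab cs hk)) (inv_mem hp)) ?_
    rwa [hup, show m * p * cs.simple k * (m * p)⁻¹ = m * (p * cs.simple k * p⁻¹) * m⁻¹ by
      group] at ht
  refine ⟨m, ⟨hmu.trans hu.1, fun t ht htG => ?_⟩, key i (by simp), key j (by simp)⟩
  by_contra hn
  have htu := hu.2 t ht htG
  have hrefl := isReflection_of_mem_invSet cs ht
  rw [hup, hm.mem_invSet_mul_iff cs hp] at htu
  have hr := invSet_subset_parab cs hp (htu.resolve_left hn)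
  have hr' := mul_mem (mul_mem (inv_mem hp) hr) hp
  have := conj_mem_invSet_of_forall_simple cs hd hN hr' (by
    have := hrefl.conj (m * p)⁻¹
    rwa [inv_inv, show (m * p)⁻¹ * t * (m * p) = p⁻¹ * (m⁻¹ * t * m) * p by group] at this)
  rw [hup, show m * p * (p⁻¹ * (m⁻¹ * t * m) * p) * (m * p)⁻¹ = t by group] at this
  exact notMem_invSet_of_conj_mem ha htG this

theorem InFib.isFibMin_eq_self {u w : W} (hu : InFib cs a D x u) (hmin : IsFibMin cs a D u)
    (hw : InFib cs a D x w) (hs : invSet cs w ⊆ invSet cs u) : w = u := by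
  by_contra hne
  obtain ⟨i, hi, hn⟩ := exists_isRightDescent_of_invSet_subset cs hs hne
  exact hn (hw.2 _ (hu.1 ((isRightDescent_iff_mem cs).mp hi)) (hmin i hi))

theorem InFib.exists_step {u w : W} (hu : InFib cs a D x u) (hw : InFib cs a D x w)
    (hs : invSet cs w ⊆ invSet cs u) (hne : w ≠ u) :
    ∃ i, cs.IsRightDescent u i ∧ a⁻¹ * (u * cs.simple i * u⁻¹) * a ∉ parab cs D ∧
      invSet cs w ⊆ invSet cs (u * cs.simple i) := by
  obtain ⟨i, hi, hn⟩ := exists_isRightDescent_of_invSet_subset cs hs hne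
  refine ⟨i, hi, fun h => hn (hw.2 _ (hu.1 ((isRightDescent_iff_mem cs).mp hi)) h), ?_⟩
  intro t ht
  rw [mem_invSet_mul_simple cs hi]
  exact ⟨hs ht, by rintro rfl; exact hn ht⟩

theorem isFibMin_unique_of_subset [Finite W] (ha : IsMinRep cs D a) (hx : x ∈ parab cs D) {u : W}
    (hu : InFib cs a D x u) {w₁ w₂ : W} (h₁ : InFib cs a D x w₁) (h₂ : InFib cs a D x w₂)
    (hm₁ : IsFibMin cs a D w₁) (hm₂ : IsFibMin cs a D w₂)
    (hs₁ : invSet cs w₁ ⊆ invSet cs u) (hs₂ : invSet cs w₂ ⊆ invSet cs u) : w₁ = w₂ := by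
  induction hn : cs.length u using Nat.strong_induction_on generalizing u w₁ w₂ with
  | _ n ih =>
    subst hn
    by_cases e₁ : w₁ = u
    · subst e₁
      exact (h₁.isFibMin_eq_self hm₁ h₂ hs₂).symm
    by_cases e₂ : w₂ = u
    · subst e₂
      exact h₂.isFibMin_eq_self hm₂ h₁ hs₁
    obtain ⟨i, hi, hiG, hsi⟩ := hu.exists_step h₁ hs₁ e₁
    obtain ⟨j, hj, hjG, hsj⟩ := hu.exists_step h₂ hs₂ e₂
    obtain ⟨m, hm, hmi, hmj⟩ := hu.confluence ha hx hi hj hiG hjG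
    obtain ⟨w, hw, hwm, hws⟩ := exists_isFibMin hm
    rw [ih _ (length_mul_simple_lt hi) (hu.mul_simple hi hiG) h₁ hw hm₁ hwm hsi
      (hws.trans hmi) rfl]
    exact ih _ (length_mul_simple_lt hj) (hu.mul_simple hj hjG) hw h₂ hwm hm₂
      (hws.trans hmj) hsj rfl

theorem isFibMin_unique [Finite W] (ha : IsMinRep cs D a) (hx : x ∈ parab cs D) {w₁ w₂ : W}
    (h₁ : InFib cs a D x w₁) (h₂ : InFib cs a D x w₂)
    (hm₁ : IsFibMin cs a D w₁) (hm₂ : IsFibMin cs a D w₂) : w₁ = w₂ :=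
  isFibMin_unique_of_subset ha hx inFib_self h₁ h₂ hm₁ hm₂ h₁.1 h₂.1

end Fibre

section FibreCovers

variable {cs} {a x : W} {D : Set B}

theorem conj_mem_parab_iff {t y : W} (hy : y ∈ parab cs D) :
    y * t * y⁻¹ ∈ parab cs D ↔ t ∈ parab cs D := by
  rw [Subgroup.mul_mem_cancel_right _ (inv_mem hy), Subgroup.mul_mem_cancel_left _ hy]

theorem eq_simple_of_conj_mem [Finite W] (ha : IsMinRep cs D a) (hx : x ∈ parab cs D) {u : W}
    (hu : InFib cs a D x u) {i j : B} (hi : cs.IsRightDescent u i) (hj : cs.IsRightDescent u j)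
    (hiG : a⁻¹ * (u * cs.simple i * u⁻¹) * a ∉ parab cs D)
    (hjG : a⁻¹ * (u * cs.simple j * u⁻¹) * a ∈ parab cs D) {r : W}
    (hr : r ∈ parab cs {i, j}) (hrefl : cs.IsReflection r)
    (hrG : a⁻¹ * (u * r * u⁻¹) * a ∈ parab cs D) : r = cs.simple j := by
  have hd : ∀ k ∈ ({i, j} : Set B), cs.IsRightDescent u k := by
    rintro k (rfl | rfl)
    exacts [hi, hj]
  obtain ⟨k, hk, hkN⟩ := exists_parab_conj_mem_iff cs a hd
  have key : ∀ r ∈ parab cs {i, j}, cs.IsReflection r →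
      (r ∈ invSet cs k ↔ a⁻¹ * (u * r * u⁻¹) * a ∈ parab cs D) := by
    intro r hr hrefl
    have h1 := hkN r hr hrefl
    rw [mem_invSet_iff_conj_notMem ha hx
      (hu.1 (conj_mem_invSet_of_forall_isRightDescent cs hd hr hrefl))] at h1
    exact (not_iff_not.mp h1).symm
  have hiI : cs.simple i ∈ parab cs {i, j} := simple_mem_parab cs (by simp)
  have hjI : cs.simple j ∈ parab cs {i, j} := simple_mem_parab cs (by simp)
  have hik := (key _ hiI (cs.isReflection_simple i)).not.mpr hiG
  have hjk := (key _ hjI (cs.isReflection_simple j)).mpr hjG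
  have hk1 : (cs.simple j * k)⁻¹ = 1 := by
    by_contra hne
    obtain ⟨l, hl, hdl⟩ := exists_isRightDescent_of_mem_parab cs (inv_mem (mul_mem hjI hk)) hne
    rw [isRightDescent_iff_mem, ← mem_invSet_inv, inv_inv, mem_invSet_mul, invSet_simple,
      Set.mem_singleton_iff] at hdl
    rcases hl with rfl | rfl
    · have hne : cs.simple l ≠ cs.simple j := by
        intro h
        exact hik (h ▸ hjk)
      simp only [hne, false_iff, not_not] at hdl
      rw [key _ (mul_mem (mul_mem (inv_mem hjI) hiI) hjI)
        (by simpa using (cs.isReflection_simple l).conj (cs.simple j)⁻¹)] at hdl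
      apply hiG
      have := mul_mem (mul_mem hjG hdl) (inv_mem hjG)
      rwa [show a⁻¹ * (u * cs.simple j * u⁻¹) * a *
        (a⁻¹ * (u * ((cs.simple j)⁻¹ * cs.simple l * cs.simple j) * u⁻¹) * a) *
        (a⁻¹ * (u * cs.simple j * u⁻¹) * a)⁻¹ = a⁻¹ * (u * cs.simple l * u⁻¹) * a by group] at this
    · simp [hjk] at hdl
  have hkj : k = cs.simple j := by
    have := inv_eq_one.mp hk1
    rw [← mul_right_inj (cs.simple j), this, cs.simple_mul_simple_self]
  have := (key r hr hrefl).mpr hrG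
  rwa [hkj, invSet_simple] at this

theorem InFib.exists_isFibMin_of_conj_mem [Finite W] (ha : IsMinRep cs D a)
    (hx : x ∈ parab cs D) {u : W} (hu : InFib cs a D x u) {j : B}
    (hj : cs.IsRightDescent u j) (hjG : a⁻¹ * (u * cs.simple j * u⁻¹) * a ∈ parab cs D) :
    ∃ w k, InFib cs a D x w ∧ IsFibMin cs a D w ∧ cs.IsRightDescent w k ∧
      w * cs.simple k * w⁻¹ = u * cs.simple j * u⁻¹ := by
  induction hn : cs.length u using Nat.strong_induction_on generalizing u j with
  | _ n ih =>
    subst hn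
    by_cases hmin : IsFibMin cs a D u
    · exact ⟨u, j, hu, hmin, hj, rfl⟩
    rw [IsFibMin] at hmin
    push Not at hmin
    obtain ⟨i, hi, hiG⟩ := hmin
    have hd : ∀ k ∈ ({i, j} : Set B), cs.IsRightDescent u k := by
      rintro k (rfl | rfl)
      exacts [hi, hj]
    obtain ⟨m, p, hm, hp, hup⟩ := exists_isMinRep cs {i, j} u
    set t := u * cs.simple j * u⁻¹ with ht
    have htu : t ∈ invSet cs u := (isRightDescent_iff_mem cs).mp hj
    have hti : t ∈ invSet cs (u * cs.simple i) := by
      rw [mem_invSet_mul_simple cs hi]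
      exact ⟨htu, fun h => hiG (h ▸ hjG)⟩
    obtain ⟨q, ⟨hq, htq⟩, hqmin⟩ := Set.exists_min_image
      {q | q ∈ parab cs {i, j} ∧ t ∈ invSet cs (u * q)} (fun q => cs.length (u * q))
      (Set.toFinite _) ⟨cs.simple i, simple_mem_parab cs (by simp), hti⟩
    have hlt : cs.length (u * q) < cs.length u :=
      (hqmin _ ⟨simple_mem_parab cs (by simp), hti⟩).trans_lt (length_mul_simple_lt hi)
    have hmq : u * q = m * (p * q) := by rw [hup, mul_assoc]
    have hr : ∀ t', cs.IsReflection t' → m⁻¹ * t' * m ∈ parab cs {i, j} →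
        ∃ r ∈ parab cs {i, j}, cs.IsReflection r ∧ t' = u * r * u⁻¹ := by
      intro t' hrefl h'
      refine ⟨p⁻¹ * (m⁻¹ * t' * m) * p, mul_mem (mul_mem (inv_mem hp) h') hp, ?_, ?_⟩
      · have := hrefl.conj (m * p)⁻¹
        rwa [inv_inv, show (m * p)⁻¹ * t' * (m * p) = p⁻¹ * (m⁻¹ * t' * m) * p by group] at this
      · rw [hup]; group
    have hfib : InFib cs a D x (u * q) := by
      refine ⟨fun t' ht' => hu.1 ?_, fun t' ht' htG => ?_⟩
      · have hrefl := isReflection_of_mem_invSet cs ht'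
        rw [hmq, hm.mem_invSet_mul_iff cs (mul_mem hp hq)] at ht'
        rcases ht' with h | h
        · rw [hup, hm.mem_invSet_mul_iff cs hp]
          exact Or.inl h
        · obtain ⟨r, hrI, hrr, rfl⟩ :=
            hr t' hrefl (invSet_subset_parab cs (mul_mem hp hq) h)
          exact conj_mem_invSet_of_forall_isRightDescent cs hd hrI hrr
      · have h := hu.2 t' ht' htG
        have hrefl := isReflection_of_mem_invSet cs ht'
        rw [hup, hm.mem_invSet_mul_iff cs hp] at h
        rcases h with h | h
        · rw [hmq, hm.mem_invSet_mul_iff cs (mul_mem hp hq)]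
          exact Or.inl h
        · obtain ⟨r, hrI, hrr, rfl⟩ := hr t' hrefl (invSet_subset_parab cs hp h)
          rwa [eq_simple_of_conj_mem ha hx hu hi hj hiG hjG hrI hrr htG]
    have hdesc : ∃ k ∈ ({i, j} : Set B), cs.IsRightDescent (u * q) k := by
      by_contra hno
      push Not at hno
      have hmr : IsMinRep cs {i, j} (u * q) := hno
      refine hmr.conj_notMem_invSet cs (r := q⁻¹ * cs.simple j * q)
        (mul_mem (mul_mem (inv_mem hq) (simple_mem_parab cs (by simp))) hq) ?_
      rwa [show u * q * (q⁻¹ * cs.simple j * q) * (u * q)⁻¹ = u * cs.simple j * u⁻¹ by group]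
    obtain ⟨k, hk, hkd⟩ := hdesc
    have hkt : u * q * cs.simple k * (u * q)⁻¹ = t := by
      by_contra hne
      have h1 : t ∈ invSet cs (u * q * cs.simple k) := by
        rw [mem_invSet_mul_simple cs hkd]
        exact ⟨htq, fun h => hne h.symm⟩
      rw [mul_assoc] at h1
      have h2 := hqmin _ ⟨mul_mem hq (simple_mem_parab cs hk), h1⟩
      rw [← mul_assoc] at h2
      exact (length_mul_simple_lt hkd).not_ge h2
    obtain ⟨w, l, hw, hw', hl, hwt⟩ := ih _ hlt hfib hkd (hkt ▸ hjG) rfl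
    exact ⟨w, l, hw, hw', hl, hwt.trans hkt⟩

/-- The restriction of `N(w)` to `a * W_D * a⁻¹` is the conjugate of an inversion set in `W_D`. -/
theorem exists_mem_parab_conj_mem_iff (ha : IsMinRep cs D a) (w : W) :
    ∃ y ∈ parab cs D, ∀ r ∈ parab cs D, a * r * a⁻¹ ∈ invSet cs w ↔ r ∈ invSet cs y := by
  obtain ⟨m, p, hm, hp, h⟩ := exists_isMinRep cs D (w⁻¹ * a)
  refine ⟨p⁻¹, inv_mem hp, fun r hr => ?_⟩
  have hw : w = a * (m * p)⁻¹ := by rw [← h]; group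
  have hna := ha.conj_notMem_invSet cs hr
  rw [hw, mem_invSet_mul, show a⁻¹ * (a * r * a⁻¹) * a = r by group, mem_invSet_inv cs (w := m * p),
    show m * p * r * (m * p)⁻¹ = m * (p * r * p⁻¹) * m⁻¹ by group,
    hm.conj_mem_invSet_mul_iff cs (mul_mem (mul_mem hp hr) (inv_mem hp)), ← mem_invSet_inv cs (w := p)]
  tauto

theorem InFib.conj_mem_iff (ha : IsMinRep cs D a) {w : W} (hw : InFib cs a D x w) {r : W}
    (hr : r ∈ parab cs D) : a * r * a⁻¹ ∈ invSet cs w ↔ r ∈ invSet cs x := by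
  rw [← ha.conj_mem_invSet_mul_iff cs (p := x) hr]
  refine ⟨fun h => hw.1 h, fun h => hw.2 _ h ?_⟩
  rwa [show a⁻¹ * (a * r * a⁻¹) * a = r by group]

/-- The cover reflections `w * s * w⁻¹` of a minimal `w` in the fibre of `x` are those of `a * x`
coming from the right descents of `x`. -/
theorem InFib.conj_eq_of_isFibMin [Finite W] [Fintype B] (ha : IsMinRep cs D a)
    (hx : x ∈ parab cs D) {w : W} (hw : InFib cs a D x w) (hmin : IsFibMin cs a D w) (t : W) :
    (∃ i, cs.IsRightDescent w i ∧ t = w * cs.simple i * w⁻¹) ↔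
      ∃ i, cs.IsRightDescent x i ∧ t = a * x * cs.simple i * (a * x)⁻¹ := by
  constructor
  · rintro ⟨i, hi, rfl⟩
    set r := a⁻¹ * (w * cs.simple i * w⁻¹) * a with hr
    have hrt : w * cs.simple i * w⁻¹ = a * r * a⁻¹ := by rw [hr]; group
    have hrD : r ∈ parab cs D := hmin i hi
    have hrx : r ∈ invSet cs x := by
      rw [← hw.conj_mem_iff ha hrD, ← hrt]
      exact (isRightDescent_iff_mem cs).mp hi
    obtain ⟨y, hy, hyN⟩ := exists_mem_parab_conj_mem_iff ha (w * cs.simple i)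
    have hyx : ∀ r' ∈ parab cs D, r' ∈ invSet cs y ↔ r' ∈ invSet cs x ∧ r' ≠ r := by
      intro r' hr'
      rw [← hyN r' hr', mem_invSet_mul_simple cs hi, hw.conj_mem_iff ha hr', hrt]
      simp
    have hry := hyx r hrD
    obtain ⟨k, hk, hkn⟩ := exists_isRightDescent_of_invSet_subset cs (w := y) (u := x)
      (fun r' h => ((hyx r' (invSet_subset_parab cs hy h)).mp h).1)
      (by rintro rfl; exact (hry.mp hrx).2 rfl)
    have hkx := (isRightDescent_iff_mem cs).mp hk
    rw [hyx _ (invSet_subset_parab cs hx hkx)] at hkn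
    refine ⟨k, hk, ?_⟩
    rw [hrt, show r = x * cs.simple k * x⁻¹ by by_contra hne; exact hkn ⟨hkx, Ne.symm hne⟩]
    group
  · rintro ⟨k, hk, rfl⟩
    have hkD := mem_of_isRightDescent_of_mem_parab cs hx hk
    have hkd : cs.IsRightDescent (a * x) k := (ha.isRightDescent_mul_iff cs hx hkD).mpr hk
    obtain ⟨w', l, hw', hm', hl, h⟩ := inFib_self.exists_isFibMin_of_conj_mem ha hx hkd (by
      rw [show a⁻¹ * (a * x * cs.simple k * (a * x)⁻¹) * a = x * cs.simple k * x⁻¹ by group]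
      exact mul_mem (mul_mem hx (simple_mem_parab cs hkD)) (inv_mem hx))
    rw [isFibMin_unique ha hx hw' hw hm' hmin] at hl h
    exact ⟨l, hl, h.symm⟩

end FibreCovers

/-! ### Alternating sums over parabolic subgroups -/

theorem sum_neg_one_pow_ncard_between {α : Type*} [Fintype α] (I J : Set α) :
    (∑ K : Set α, if I ⊆ K ∧ K ⊆ J then (-1 : ℤ) ^ K.ncard else 0) =
      if I = J then (-1) ^ J.ncard else 0 := by
  by_cases hIJ : I = J
  · subst hIJ
    rw [Finset.sum_eq_single I]
    · simp
    · intro K _ hK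
      rw [if_neg]
      rintro ⟨h1, h2⟩
      exact hK (h2.antisymm h1)
    · simp
  rw [if_neg hIJ]
  by_cases hs : I ⊆ J
  swap
  · exact Finset.sum_eq_zero fun K _ => if_neg fun h => hs (h.1.trans h.2)
  obtain ⟨b, hbJ, hbI⟩ := Set.not_subset.mp fun h => hIJ (hs.antisymm h)
  have key : ∀ K : Set α, b ∉ K → (if I ⊆ K ∧ K ⊆ J then (-1 : ℤ) ^ K.ncard else 0) +
      (if I ⊆ insert b K ∧ insert b K ⊆ J then (-1 : ℤ) ^ (insert b K).ncard else 0) = 0 := by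
    intro K hK
    have h1 : I ⊆ insert b K ↔ I ⊆ K := Set.subset_insert_iff_of_notMem hbI
    have h2 : insert b K ⊆ J ↔ K ⊆ J := by simp [Set.insert_subset_iff, hbJ]
    rw [h1, h2, Set.ncard_insert_of_notMem hK (Set.toFinite K)]
    split_ifs <;> ring
  refine Finset.sum_involution (fun K _ => if b ∈ K then K \ {b} else insert b K) ?_ ?_ ?_ ?_
  · intro K _
    by_cases hK : b ∈ K
    · have := key (K \ {b}) (by simp)
      rw [Set.insert_sdiff_singleton, Set.insert_eq_of_mem hK] at this
      rw [if_pos hK, add_comm]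
      exact this
    · rw [if_neg hK]
      exact key K hK
  · intro K _ _ h
    by_cases hK : b ∈ K
    · rw [if_pos hK] at h
      rw [← h] at hK
      simp at hK
    · rw [if_neg hK] at h
      exact hK (h ▸ Set.mem_insert b K)
  · simp
  · intro K _
    by_cases hK : b ∈ K
    · simp [hK]
    · simp [hK]

/-- The alternating sum of the orders of the subgroups generated by the subsets of `C`. -/
noncomputable def altClosureSum [Fintype W] (C : Set W) : ℤ :=
  ∑ T : Set W, if T ⊆ C then (-1) ^ T.ncard * (Nat.card (Subgroup.closure T) : ℤ) else 0

/-- The alternating sum of the orders of the parabolic subgroups `W_K` for `K ⊆ J`. -/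
noncomputable def altParabSum [Fintype B] (J : Set B) : ℤ :=
  ∑ K : Set B, if K ⊆ J then (-1) ^ K.ncard * (Nat.card (parab cs K) : ℤ) else 0

theorem altClosureSum_image_simple [Fintype W] [Fintype B] (J : Set B) :
    altClosureSum (cs.simple '' J) = altParabSum cs J := by
  rw [altClosureSum, altParabSum, ← Finset.sum_filter, ← Finset.sum_filter]
  symm
  refine Finset.sum_nbij' (fun K => cs.simple '' K) (fun T => cs.simple ⁻¹' T) ?_ ?_ ?_ ?_ ?_
  · intro K hK
    simpa using Set.image_mono (by simpa using hK)
  · intro T hT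
    have hT' : T ⊆ cs.simple '' J := by simpa using hT
    have := Set.preimage_mono (f := cs.simple) hT'
    rw [Set.preimage_image_eq _ (simple_injective cs)] at this
    simpa using this
  · intro K _
    exact Set.preimage_image_eq _ (simple_injective cs)
  · intro T hT
    have hT' : T ⊆ cs.simple '' J := by simpa using hT
    exact Set.image_preimage_eq_of_subset (hT'.trans (Set.image_subset_range _ _))
  · intro K _
    rw [Set.ncard_image_of_injective _ (simple_injective cs), parab]

theorem altClosureSum_image [Fintype W] (e : W ≃* W) (C : Set W) :
    altClosureSum (e '' C) = altClosureSum C := by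
  rw [altClosureSum, altClosureSum]
  symm
  refine Fintype.sum_equiv (Equiv.Set.congr e.toEquiv) _ _ fun T => ?_
  have h1 : (Equiv.Set.congr e.toEquiv) T = e '' T := rfl
  rw [h1, Set.image_subset_image_iff e.injective, Set.ncard_image_of_injective _ e.injective]
  have h2 : Subgroup.closure (e '' T) = (Subgroup.closure T).map e.toMonoidHom :=
    (MonoidHom.map_closure e.toMonoidHom T).symm
  rw [h2, Nat.card_congr (Subgroup.equivMapOfInjective _ e.toMonoidHom e.injective).toEquiv]

theorem altClosureSum_conj [Fintype W] [Fintype B] (w : W) (J : Set B) :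
    altClosureSum {t | ∃ i, i ∈ J ∧ t = w * cs.simple i * w⁻¹} = altParabSum cs J := by
  rw [← altClosureSum_image_simple, ← altClosureSum_image (MulAut.conj w) (cs.simple '' J)]
  congr 1
  ext t
  simp [eq_comm]

/-! ### Counting in parabolic subgroups -/

theorem card_parab_mul_card_descents [Fintype W] [Fintype B] {K D : Set B} (hKD : K ⊆ D) :
    Nat.card (parab cs K) * Nat.card {x : W | x ∈ parab cs D ∧ K ⊆ {i | cs.IsRightDescent x i}} =
      Nat.card (parab cs D) := by
  rw [← Nat.card_prod]
  refine Nat.card_congr (Equiv.ofBijective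
    (fun y => ⟨y.2.1 * y.1.1, mul_mem y.2.2.1 (parab_mono cs hKD y.1.2)⟩) ⟨?_, ?_⟩)
  · rintro ⟨⟨p, hp⟩, ⟨x, hx, hxK⟩⟩ ⟨⟨p', hp'⟩, ⟨x', hx', hxK'⟩⟩ h
    have h' : x * p = x' * p' := congrArg Subtype.val h
    obtain ⟨m, q, hm, hq, rfl⟩ := exists_isMinRep cs K x
    obtain ⟨m', q', hm', hq', rfl⟩ := exists_isMinRep cs K x'
    have hqd : ∀ i ∈ K, cs.IsRightDescent q i := fun i hi =>
      (hm.isRightDescent_mul_iff cs hq hi).mp (hxK hi)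
    have hqd' : ∀ i ∈ K, cs.IsRightDescent q' i := fun i hi =>
      (hm'.isRightDescent_mul_iff cs hq' hi).mp (hxK' hi)
    have hqq : q = q' := invSet_injective cs (Set.Subset.antisymm
      (fun t ht => mem_invSet_of_forall_isRightDescent cs hq' hqd'
        (invSet_subset_parab cs hq ht) (isReflection_of_mem_invSet cs ht))
      (fun t ht => mem_invSet_of_forall_isRightDescent cs hq hqd
        (invSet_subset_parab cs hq' ht) (isReflection_of_mem_invSet cs ht)))
    rw [mul_assoc, mul_assoc] at h'
    obtain ⟨rfl, h2⟩ := hm.eq_of_mul_eq cs hm' (mul_mem hq hp) (mul_mem hq' hp') h'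
    subst hqq
    have := mul_left_cancel h2
    subst this
    rfl
  · rintro ⟨y, hy⟩
    obtain ⟨m, q, hm, hq, rfl⟩ := exists_isMinRep cs K y
    obtain ⟨p, hp, hall⟩ := exists_parab_longest cs K
    have hmD : m ∈ parab cs D := by
      have := mul_mem hy (inv_mem (parab_mono cs hKD hq))
      rwa [mul_inv_cancel_right] at this
    refine ⟨⟨⟨p⁻¹ * q, mul_mem (inv_mem hp) hq⟩,
      ⟨m * p, mul_mem hmD (parab_mono cs hKD hp), fun i hi => ?_⟩⟩, ?_⟩
    · rw [Set.mem_ofPred_eq, hm.isRightDescent_mul_iff cs hp hi, isRightDescent_iff_mem]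
      exact hall _ (mul_mem (mul_mem hp (simple_mem_parab cs hi)) (inv_mem hp))
        ((cs.isReflection_simple i).conj p)
    · simp only [Subtype.mk.injEq]
      group

theorem sum_altParabSum_descents [Fintype W] [Fintype B] (D : Set B) :
    (∑ x : W, if x ∈ parab cs D then altParabSum cs {i | cs.IsRightDescent x i} else 0) =
      if D = ∅ then 1 else 0 := by
  have h1 : ∀ x : W, (if x ∈ parab cs D then altParabSum cs {i | cs.IsRightDescent x i} else 0) =
      ∑ K : Set B, if K ⊆ D ∧ x ∈ parab cs D ∧ K ⊆ {i | cs.IsRightDescent x i} then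
        (-1) ^ K.ncard * (Nat.card (parab cs K) : ℤ) else 0 := by
    intro x
    split_ifs with hx
    · refine Finset.sum_congr rfl fun K _ => ?_
      have : K ⊆ {i | cs.IsRightDescent x i} → K ⊆ D := fun h i hi =>
        mem_of_isRightDescent_of_mem_parab cs hx (h hi)
      by_cases hK : K ⊆ {i | cs.IsRightDescent x i}
      · rw [if_pos hK, if_pos ⟨this hK, hx, hK⟩]
      · rw [if_neg hK, if_neg fun h => hK h.2.2]
    · exact (Finset.sum_eq_zero fun K _ => if_neg fun h => hx h.2.1).symm
  simp_rw [h1]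
  rw [Finset.sum_comm]
  have h2 : ∀ K : Set B,
      (∑ x : W, if K ⊆ D ∧ x ∈ parab cs D ∧ K ⊆ {i | cs.IsRightDescent x i} then
        (-1) ^ K.ncard * (Nat.card (parab cs K) : ℤ) else 0) =
      (if ∅ ⊆ K ∧ K ⊆ D then (-1) ^ K.ncard else 0) * (Nat.card (parab cs D) : ℤ) := by
    intro K
    by_cases hK : K ⊆ D
    · rw [if_pos ⟨Set.empty_subset K, hK⟩, ← card_parab_mul_card_descents cs hK]
      simp only [hK, true_and]
      have hc : Nat.card {x : W | x ∈ parab cs D ∧ K ⊆ {i | cs.IsRightDescent x i}} =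
          (Finset.univ.filter fun x : W =>
            x ∈ parab cs D ∧ K ⊆ {i | cs.IsRightDescent x i}).card := by
        rw [Nat.card_eq_fintype_card]
        exact Fintype.card_subtype _
      rw [← Finset.sum_filter, Finset.sum_const, hc, nsmul_eq_mul]
      push_cast
      ring
    · simp [hK]
  simp_rw [h2]
  rw [← Finset.sum_mul, sum_neg_one_pow_ncard_between]
  by_cases hD : D = ∅
  · subst hD
    simp [parab]
  · rw [if_neg fun h => hD h.symm, if_neg hD, zero_mul]

/-! ### The Möbius function of the shard intersection order -/

theorem descConj_eq_map (v : W) : descConj cs v =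
    (parab cs {i | cs.IsRightDescent v i}).map (MulAut.conj v).toMonoidHom := by
  rw [descConj, parab, MonoidHom.map_closure]
  congr 1
  ext t
  simp [eq_comm]

theorem shardLE_refl (v : W) : shardLE cs v v := ⟨subset_rfl, le_rfl⟩

theorem shardLE_one_left (v : W) : shardLE cs 1 v := by
  refine ⟨by rw [invSet_one]; exact Set.empty_subset _, ?_⟩
  rw [descConj, Subgroup.closure_le]
  rintro t ⟨i, hi, _⟩
  rw [isRightDescent_iff_mem, invSet_one] at hi
  exact hi.elim

section ShardFibre

variable {cs} {a p v : W} {D : Set B}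

theorem mem_descConj_iff (hD : D = {i | cs.IsRightDescent v i}) (hp : p ∈ parab cs D)
    (hv : v = a * p) {t : W} : t ∈ descConj cs v ↔ a⁻¹ * t * a ∈ parab cs D := by
  rw [descConj_eq_map, ← hD, Subgroup.mem_map_equiv, MulAut.conj_symm_apply, hv,
    ← conj_mem_parab_iff hp]
  group

theorem mem_invSet_iff_of_eq [Finite W] (ha : IsMinRep cs D a)
    (hD : D = {i | cs.IsRightDescent v i}) (hp : p ∈ parab cs D) (hv : v = a * p) {t : W}
    (ht : cs.IsReflection t) :
    t ∈ invSet cs v ↔ t ∈ invSet cs a ∨ a⁻¹ * t * a ∈ parab cs D := by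
  rw [hv, ha.mem_invSet_mul_iff cs hp]
  refine or_congr Iff.rfl ⟨fun h => invSet_subset_parab cs hp h, fun h => ?_⟩
  refine mem_invSet_of_forall_isRightDescent cs hp (fun i hi => ?_) h
    (by simpa using ht.conj a⁻¹)
  rw [← ha.isRightDescent_mul_iff cs hp hi, ← hv]
  rwa [hD] at hi

theorem shardLE_of_isFibMin [Finite W] (ha : IsMinRep cs D a)
    (hD : D = {i | cs.IsRightDescent v i}) (hp : p ∈ parab cs D) (hv : v = a * p) {x w : W}
    (hx : x ∈ parab cs D) (hw : InFib cs a D x w) (hm : IsFibMin cs a D w) :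
    shardLE cs w v := by
  refine ⟨fun t ht => ?_, ?_⟩
  · rw [mem_invSet_iff_of_eq ha hD hp hv (isReflection_of_mem_invSet cs ht)]
    exact ((ha.mem_invSet_mul_iff cs hx).mp (hw.1 ht)).imp id
      fun h => invSet_subset_parab cs hx h
  · rw [descConj, Subgroup.closure_le]
    rintro t ⟨i, hi, rfl⟩
    exact (mem_descConj_iff hD hp hv).mpr (hm i hi)

theorem exists_inFib_of_shardLE [Finite W] (ha : IsMinRep cs D a)
    (hD : D = {i | cs.IsRightDescent v i}) (hp : p ∈ parab cs D) (hv : v = a * p) {w : W}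
    (hw : shardLE cs w v) :
    IsFibMin cs a D w ∧ ∃ x ∈ parab cs D, InFib cs a D x w := by
  refine ⟨fun i hi => ?_, ?_⟩
  · rw [← mem_descConj_iff hD hp hv]
    exact hw.2 (Subgroup.subset_closure ⟨i, hi, rfl⟩)
  obtain ⟨y, hy, hyN⟩ := exists_mem_parab_conj_mem_iff ha w
  refine ⟨y, hy, fun t ht => ?_, fun t ht htG => ?_⟩
  · rw [ha.mem_invSet_mul_iff cs hy]
    refine ((mem_invSet_iff_of_eq ha hD hp hv
      (isReflection_of_mem_invSet cs ht)).mp (hw.1 ht)).imp id fun h => ?_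
    rw [← hyN _ h]
    rwa [show a * (a⁻¹ * t * a) * a⁻¹ = t by group]
  · have h := ((ha.mem_invSet_mul_iff cs hy).mp ht).resolve_left
      (notMem_invSet_of_conj_mem ha htG)
    rw [← hyN _ htG] at h
    rwa [show a * (a⁻¹ * t * a) * a⁻¹ = t by group] at h

theorem InFib.eq_of_inFib (ha : IsMinRep cs D a) {x y w : W} (hx : x ∈ parab cs D)
    (hy : y ∈ parab cs D) (hwx : InFib cs a D x w) (hwy : InFib cs a D y w) : x = y := by
  apply invSet_injective cs
  ext r
  constructor
  · intro h
    have hr := invSet_subset_parab cs hx h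
    rwa [← hwy.conj_mem_iff ha hr, hwx.conj_mem_iff ha hr]
  · intro h
    have hr := invSet_subset_parab cs hy h
    rwa [← hwx.conj_mem_iff ha hr, hwy.conj_mem_iff ha hr]

theorem altParabSum_eq_of_isFibMin [Fintype W] [Fintype B] (ha : IsMinRep cs D a) {x w : W}
    (hx : x ∈ parab cs D) (hw : InFib cs a D x w) (hm : IsFibMin cs a D w) :
    altParabSum cs {i | cs.IsRightDescent w i} = altParabSum cs {i | cs.IsRightDescent x i} := by
  rw [← altClosureSum_conj cs w, ← altClosureSum_conj cs (a * x)]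
  congr 1
  ext t
  exact hw.conj_eq_of_isFibMin ha hx hm t

end ShardFibre

theorem sum_shardLE_altParabSum [Fintype W] [Fintype B] (v : W) :
    (∑ w : W, if shardLE cs w v then altParabSum cs {i | cs.IsRightDescent w i} else 0) =
      if v = 1 then 1 else 0 := by
  obtain ⟨D, hD⟩ : ∃ D, D = {i | cs.IsRightDescent v i} := ⟨_, rfl⟩
  obtain ⟨a, p, ha, hp, hv⟩ := exists_isMinRep cs D v
  have h1 : v = 1 ↔ D = ∅ := by
    rw [hD]
    refine ⟨?_, fun h => ?_⟩
    · rintro rfl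
      ext i
      simp [isRightDescent_iff_mem, invSet_one]
    · by_contra hne
      obtain ⟨i, hi⟩ := cs.exists_rightDescent_of_ne_one hne
      exact Set.eq_empty_iff_forall_notMem.mp h i hi
  simp only [h1]
  rw [← sum_altParabSum_descents cs D, ← Finset.sum_filter, ← Finset.sum_filter]
  choose f hf hfm _ using fun x => exists_isFibMin (inFib_self (cs := cs) (a := a) (x := x) (D := D))
  symm
  refine Finset.sum_nbij f ?_ ?_ ?_ ?_
  · intro x hx
    have hx : x ∈ parab cs D := by simpa using hx
    simpa using shardLE_of_isFibMin ha hD hp hv hx (hf x) (hfm x)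
  · intro x hx y hy hxy
    have hx : x ∈ parab cs D := by simpa using hx
    have hy : y ∈ parab cs D := by simpa using hy
    exact (hf x).eq_of_inFib ha hx hy (hxy ▸ hf y)
  · intro w hw
    have hw : shardLE cs w v := by simpa using hw
    obtain ⟨hm, x, hx, hwx⟩ := exists_inFib_of_shardLE ha hD hp hv hw
    exact ⟨x, by simpa using hx, isFibMin_unique ha hx (hf x) hwx (hfm x) hm⟩
  · intro x hx
    have hx : x ∈ parab cs D := by simpa using hx
    exact (altParabSum_eq_of_isFibMin ha hx (hf x) (hfm x)).symm

theorem mobius_shard_eq_altParabSum [Fintype W] [Fintype B] (μσ : W → W → ℤ)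
    (hσ1 : ∀ u v : W, shardLE cs u v →
      (∑ w : W, if shardLE cs u w ∧ shardLE cs w v then μσ u w else 0) =
        if u = v then 1 else 0) (v : W) :
    μσ 1 v = altParabSum cs {i | cs.IsRightDescent v i} := by
  induction hn : cs.length v using Nat.strong_induction_on generalizing v with
  | _ n ih =>
    subst hn
    have h1 := hσ1 1 v (shardLE_one_left cs v)
    have h2 := sum_shardLE_altParabSum cs v
    simp only [shardLE_one_left, true_and, eq_comm (a := (1 : W))] at h1
    rw [← h2, ← sub_eq_zero, ← Finset.sum_sub_distrib, Finset.sum_eq_single v] at h1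
    · simpa [shardLE_refl, sub_eq_zero] using h1
    · intro w _ hwv
      by_cases hw : shardLE cs w v
      · rw [if_pos hw, if_pos hw, sub_eq_zero]
        exact ih _ (length_lt_of_invSet_subset cs hw.1 hwv) w rfl
      · rw [if_neg hw, if_neg hw, sub_zero]
    · simp

/-! ### Supports and parabolic components -/

theorem simple_mem_parab_of_mem_word {I : Set B} {l : List B} (hl : cs.IsReduced l)
    (h : cs.wordProd l ∈ parab cs I) : ∀ i ∈ l, cs.simple i ∈ parab cs I := by
  induction l with
  | nil => simp
  | cons i l ih =>
    have hi : cs.simple i ∈ parab cs I := by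
      refine invSet_subset_parab cs h ?_
      rw [invSet_wordProd_eq cs hl, Set.mem_ofPred_eq, CoxeterSystem.leftInvSeq]
      simp
    intro j hj
    rcases List.mem_cons.mp hj with rfl | hj
    · exact hi
    · refine ih (by simpa using hl.drop 1) ?_ j hj
      rw [cs.wordProd_cons] at h
      exact (Subgroup.mul_mem_cancel_left _ hi).mp h

theorem mem_parab_iff_supp_subset [Fintype B] {I : Set B} {w : W} :
    w ∈ parab cs I ↔ supp cs w ⊆ I := by
  constructor
  · rintro h i ⟨l, hl, rfl, hi⟩
    exact (simple_mem_parab_iff cs).mp (simple_mem_parab_of_mem_word cs hl h i hi)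
  · intro h
    obtain ⟨l, hl, rfl⟩ := cs.exists_isReduced w
    exact wordProd_mem_parab cs fun i hi => h ⟨l, hl, rfl, hi⟩

theorem mem_parab_supp [Fintype B] (w : W) : w ∈ parab cs (supp cs w) :=
  (mem_parab_iff_supp_subset cs).mpr subset_rfl

/-- The parabolic component `v_I`. -/
noncomputable def comp (I : Set B) (v : W) : W := (exists_isMinRep cs I v).choose_spec.choose

theorem exists_eq_mul_comp (I : Set B) (v : W) :
    ∃ m, IsMinRep cs I m ∧ comp cs I v ∈ parab cs I ∧ v = m * comp cs I v :=
  ⟨_, (exists_isMinRep cs I v).choose_spec.choose_spec⟩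

theorem comp_mem_parab (I : Set B) (v : W) : comp cs I v ∈ parab cs I :=
  (exists_eq_mul_comp cs I v).choose_spec.2.1

theorem IsMinRep.comp_mul {I : Set B} {m p : W} (hm : IsMinRep cs I m) (hp : p ∈ parab cs I) :
    comp cs I (m * p) = p := by
  obtain ⟨m', hm', hp', h⟩ := exists_eq_mul_comp cs I (m * p)
  exact ((hm.eq_of_mul_eq cs hm' hp hp' h).2).symm

theorem isMinRep_one (I : Set B) : IsMinRep cs I (1 : W) := fun i _ => by
  simp [isRightDescent_iff_mem, invSet_one]

theorem comp_eq_self {I : Set B} {p : W} (hp : p ∈ parab cs I) : comp cs I p = p := by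
  simpa using (isMinRep_one cs I).comp_mul cs hp

theorem comp_comp {K I : Set B} (hKI : K ⊆ I) (v : W) :
    comp cs K (comp cs I v) = comp cs K v := by
  obtain ⟨m, hm, hp, hv⟩ := exists_eq_mul_comp cs I v
  obtain ⟨m', hm', hp', hv'⟩ := exists_eq_mul_comp cs K (comp cs I v)
  have hmI : m' ∈ parab cs I := by
    rw [hv'] at hp
    exact (Subgroup.mul_mem_cancel_right _ (parab_mono cs hKI hp')).mp hp
  have hmm : IsMinRep cs K (m * m') := fun i hi => by
    rw [hm.isRightDescent_mul_iff cs hmI (hKI hi)]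
    exact hm' i hi
  have := hmm.comp_mul cs hp'
  rwa [mul_assoc, ← hv', ← hv, eq_comm] at this

theorem bhzLE_iff_comp_eq {u v : W} : bhzLE cs u v ↔ comp cs (supp cs u) v = u := by
  constructor
  · rintro ⟨hu, hm, _⟩
    simpa using hm.comp_mul cs hu
  · intro h
    obtain ⟨m, hm, hp, hv⟩ := exists_eq_mul_comp cs (supp cs u) v
    rw [h] at hp hv
    have hmv : v * u⁻¹ = m := by rw [hv]; group
    refine ⟨hp, hmv ▸ hm, ?_⟩
    rw [hmv, hv, hm.length_mul cs hp]

theorem bhzLE_refl [Fintype B] (u : W) : bhzLE cs u u :=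
  (bhzLE_iff_comp_eq cs).mpr (comp_eq_self cs (mem_parab_supp cs u))

theorem supp_subset_of_bhzLE {u v : W} (h : bhzLE cs u v) : supp cs u ⊆ supp cs v := by
  rintro i ⟨l, hl, rfl, hi⟩
  obtain ⟨l', hl', hl'm⟩ := cs.exists_isReduced (v * (cs.wordProd l)⁻¹)
  have hprod : cs.wordProd (l' ++ l) = v := by
    rw [cs.wordProd_append, ← hl'm, inv_mul_cancel_right]
  refine ⟨l' ++ l, ?_, hprod, by simp [hi]⟩
  rw [CoxeterSystem.IsReduced, hprod, h.2.2, hl, List.length_append, hl'm, hl']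

theorem bhzLE_trans {u w v : W} (huw : bhzLE cs u w) (hwv : bhzLE cs w v) : bhzLE cs u v := by
  have hs := supp_subset_of_bhzLE cs huw
  rw [bhzLE_iff_comp_eq] at *
  rw [← comp_comp cs hs, hwv, huw]

theorem bhzLE_comp_iff [Fintype B] {I : Set B} {u v : W} :
    bhzLE cs u (comp cs I v) ↔ bhzLE cs u v ∧ supp cs u ⊆ I := by
  have hI : supp cs (comp cs I v) ⊆ I :=
    (mem_parab_iff_supp_subset cs).mp (comp_mem_parab cs I v)
  have key : supp cs u ⊆ I → (bhzLE cs u (comp cs I v) ↔ bhzLE cs u v) := fun h => by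
    rw [bhzLE_iff_comp_eq, bhzLE_iff_comp_eq, comp_comp cs h]
  refine ⟨fun h => ?_, fun h => (key h.2).mpr h.1⟩
  have h' := (supp_subset_of_bhzLE cs h).trans hI
  exact ⟨(key h').mp h, h'⟩

theorem sum_sign_bhzLE_comp [Fintype W] [Fintype B] (u v : W) :
    (∑ I : Set B, if bhzLE cs u (comp cs I v) then
      (-1 : ℤ) ^ Fintype.card B * (-1) ^ I.ncard else 0) =
      if u = v ∧ supp cs v = Set.univ then 1 else 0 := by
  have hsq : (-1 : ℤ) ^ Fintype.card B * (-1) ^ Fintype.card B = 1 := by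
    rw [← mul_pow]; simp
  have h1 : ∀ I : Set B, (if bhzLE cs u (comp cs I v) then
      (-1 : ℤ) ^ Fintype.card B * (-1) ^ I.ncard else 0) =
      (if bhzLE cs u v then (-1 : ℤ) ^ Fintype.card B else 0) *
        if supp cs u ⊆ I ∧ I ⊆ Set.univ then (-1) ^ I.ncard else 0 := by
    intro I
    by_cases huv : bhzLE cs u v <;> simp [bhzLE_comp_iff, huv]
  simp_rw [h1]
  rw [← Finset.mul_sum, sum_neg_one_pow_ncard_between, Set.ncard_univ, Nat.card_eq_fintype_card]
  by_cases hu : supp cs u = Set.univ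
  · have h2 : bhzLE cs u v ↔ u = v := by
      rw [bhzLE_iff_comp_eq, hu, comp_eq_self cs, eq_comm]
      exact (mem_parab_iff_supp_subset cs).mpr (Set.subset_univ _)
    rw [h2, if_pos hu]
    by_cases huv : u = v
    · rw [if_pos huv, hsq, if_pos ⟨huv, huv ▸ hu⟩]
    · rw [if_neg huv, if_neg fun h => huv h.1, zero_mul]
  · rw [if_neg hu, mul_zero, if_neg]
    rintro ⟨rfl, h⟩
    exact hu h

/-- The Möbius function of the BHZ order below an element of full support. -/
theorem mobius_bhz_eq_sum [Fintype W] [Fintype B] (μβ : W → W → ℤ)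
    (hβ0 : ∀ u v : W, ¬ bhzLE cs u v → μβ u v = 0)
    (hβ1 : ∀ u v : W, bhzLE cs u v →
      (∑ w : W, if bhzLE cs u w ∧ bhzLE cs w v then μβ u w else 0) =
        if u = v then 1 else 0) (u v : W) :
    (if supp cs v = Set.univ then μβ u v else 0) =
      ∑ I : Set B, if comp cs I v = u then
        (-1 : ℤ) ^ Fintype.card B * (-1) ^ I.ncard else 0 := by
  have hδ : ∀ x : W, (∑ w : W, if bhzLE cs w x then μβ u w else 0) = if x = u then 1 else 0 := by
    intro x
    by_cases hux : bhzLE cs u x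
    · simp only [eq_comm (a := x)]
      rw [← hβ1 u x hux]
      refine Finset.sum_congr rfl fun w _ => ?_
      by_cases huw : bhzLE cs u w
      · simp [huw]
      · simp [huw, hβ0 u w huw]
    · rw [if_neg]
      · refine Finset.sum_eq_zero fun w _ => ?_
        split_ifs with hw
        · exact hβ0 u w fun huw => hux (bhzLE_trans cs huw hw)
        · rfl
      · rintro rfl
        exact hux (bhzLE_refl cs x)
  calc (if supp cs v = Set.univ then μβ u v else 0)
      = ∑ w : W, μβ u w * if w = v ∧ supp cs v = Set.univ then 1 else 0 := by
        simp [ite_and]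
    _ = ∑ w : W, ∑ I : Set B, (if bhzLE cs w (comp cs I v) then μβ u w else 0) *
          ((-1 : ℤ) ^ Fintype.card B * (-1) ^ I.ncard) := by
        refine Finset.sum_congr rfl fun w _ => ?_
        rw [← sum_sign_bhzLE_comp cs w v, Finset.mul_sum]
        simp only [mul_ite, ite_mul, mul_zero, zero_mul]
    _ = _ := by
        rw [Finset.sum_comm]
        refine Finset.sum_congr rfl fun I _ => ?_
        rw [← Finset.sum_mul, hδ]
        simp only [ite_mul, one_mul, zero_mul]

/-! ### Comparison of the two sums -/

theorem card_comp_filter [Finite W] (I : Set B) (Q : W → Prop) :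
    Nat.card {v : W // Q (comp cs I v)} =
      Nat.card {m : W // IsMinRep cs I m} * Nat.card {p : W // p ∈ parab cs I ∧ Q p} := by
  rw [← Nat.card_prod]
  symm
  refine Nat.card_congr (Equiv.ofBijective
    (fun y => ⟨y.1.1 * y.2.1, by rw [y.1.2.comp_mul cs y.2.2.1]; exact y.2.2.2⟩) ⟨?_, ?_⟩)
  · rintro ⟨⟨m, hm⟩, ⟨p, hp, hQ⟩⟩ ⟨⟨m', hm'⟩, ⟨p', hp', hQ'⟩⟩ h
    obtain ⟨rfl, rfl⟩ := hm.eq_of_mul_eq cs hm' hp hp' (congrArg Subtype.val h)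
    rfl
  · rintro ⟨v, hv⟩
    obtain ⟨m, hm, hp, h⟩ := exists_eq_mul_comp cs I v
    exact ⟨⟨⟨m, hm⟩, ⟨comp cs I v, hp, hv⟩⟩, Subtype.ext h.symm⟩

theorem parab_univ : parab cs Set.univ = ⊤ := by
  rw [parab, Set.image_univ, cs.subgroup_closure_range_simple]

theorem card_isMinRep [Fintype W] [Fintype B] (I : Set B) :
    Nat.card {m : W // IsMinRep cs I m} =
      Nat.card {x : W // I ⊆ {i | cs.IsRightDescent x i}} := by
  have h1 := card_comp_filter cs I fun _ => True
  have h2 := card_parab_mul_card_descents cs (Set.subset_univ I)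
  rw [Nat.card_congr (Equiv.subtypeUnivEquiv fun _ => trivial)] at h1
  rw [parab_univ, Subgroup.card_top, h1, mul_comm] at h2
  simp only [Subgroup.mem_top, true_and, and_true] at h2
  exact (Nat.eq_of_mul_eq_mul_right Nat.card_pos h2).symm

theorem card_supp_comp [Fintype W] [Fintype B] (I J : Set B) :
    Nat.card {v : W // supp cs (comp cs I v) = J} =
      if J ⊆ I then Nat.card {x : W // I ⊆ {i | cs.IsRightDescent x i}} *
        Nat.card {u : W // supp cs u = J} else 0 := by
  rw [card_comp_filter cs I fun u => supp cs u = J, card_isMinRep]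
  split_ifs with h
  · congr 1
    refine Nat.card_congr (Equiv.subtypeEquivRight fun u => ?_)
    rw [mem_parab_iff_supp_subset]
    exact ⟨fun h => h.2, fun hu => ⟨hu ▸ h, hu⟩⟩
  · have : IsEmpty {p : W // p ∈ parab cs I ∧ supp cs p = J} :=
      ⟨fun p => h (p.2.2 ▸ (mem_parab_iff_supp_subset cs).mp p.2.1)⟩
    rw [Nat.card_of_isEmpty (α := {p : W // p ∈ parab cs I ∧ supp cs p = J}), mul_zero]

theorem natCard_subtype_eq_sum {α : Type*} [Fintype α] (Q : α → Prop) :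
    (Nat.card {x : α // Q x} : ℤ) = ∑ x : α, if Q x then 1 else 0 := by
  rw [Finset.sum_boole, Nat.card_eq_fintype_card, Fintype.card_subtype]

theorem altParabSum_eq [Fintype W] [Fintype B] (J : Set B) :
    altParabSum cs J = (-1) ^ J.ncard * (Nat.card {u : W // supp cs u = J} : ℤ) := by
  have h1 : ∀ K : Set B,
      (if K ⊆ J then (-1) ^ K.ncard * (Nat.card (parab cs K) : ℤ) else 0) =
        ∑ u : W, if supp cs u ⊆ K ∧ K ⊆ J then (-1) ^ K.ncard else 0 := by
    intro K
    have : (Nat.card (parab cs K) : ℤ) = ∑ u : W, if supp cs u ⊆ K then 1 else 0 := by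
      rw [← natCard_subtype_eq_sum]
      simp_rw [← mem_parab_iff_supp_subset]
    rw [this, Finset.mul_sum]
    by_cases hK : K ⊆ J <;> simp [hK]
  rw [altParabSum]
  simp_rw [h1]
  rw [Finset.sum_comm, natCard_subtype_eq_sum, Finset.mul_sum]
  refine Finset.sum_congr rfl fun u _ => ?_
  rw [sum_neg_one_pow_ncard_between]
  simp

theorem sum_sign_card_descents [Fintype W] [Fintype B] (J : Set B) :
    (∑ I : Set B, if J ⊆ I then
      (-1 : ℤ) ^ I.ncard * (Nat.card {x : W // I ⊆ {i | cs.IsRightDescent x i}} : ℤ) else 0) =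
      (-1) ^ J.ncard * ∑ x : W, if {i | cs.IsRightDescent x i} = J then 1 else 0 := by
  have h1 : ∀ I : Set B, (if J ⊆ I then
      (-1 : ℤ) ^ I.ncard * (Nat.card {x : W // I ⊆ {i | cs.IsRightDescent x i}} : ℤ) else 0) =
        ∑ x : W, if J ⊆ I ∧ I ⊆ {i | cs.IsRightDescent x i} then (-1) ^ I.ncard else 0 := by
    intro I
    rw [natCard_subtype_eq_sum, Finset.mul_sum]
    by_cases hI : J ⊆ I <;> simp [hI]
  simp_rw [h1]
  rw [Finset.sum_comm, Finset.mul_sum]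
  refine Finset.sum_congr rfl fun x _ => ?_
  rw [sum_neg_one_pow_ncard_between]
  by_cases h : J = {i | cs.IsRightDescent x i}
  · rw [if_pos h, if_pos h.symm, ← h, mul_one]
  · rw [if_neg h, if_neg fun h' => h h'.symm, mul_zero]

theorem sum_mobius_bhz [Fintype W] [Fintype B] (μβ : W → W → ℤ)
    (hβ0 : ∀ u v : W, ¬ bhzLE cs u v → μβ u v = 0)
    (hβ1 : ∀ u v : W, bhzLE cs u v →
      (∑ w : W, if bhzLE cs u w ∧ bhzLE cs w v then μβ u w else 0) =
        if u = v then 1 else 0) (J : Set B) :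
    (∑ v : W, ∑ u : W,
      if bhzLE cs u v ∧ supp cs v = (Set.univ : Set B) ∧ supp cs u = J then μβ u v else 0) =
      (-1 : ℤ) ^ Fintype.card B *
        ∑ I : Set B, (-1 : ℤ) ^ I.ncard * Nat.card {v : W // supp cs (comp cs I v) = J} := by
  have h1 : ∀ v : W, (∑ u : W,
      if bhzLE cs u v ∧ supp cs v = (Set.univ : Set B) ∧ supp cs u = J then μβ u v else 0) =
      ∑ I : Set B, (-1 : ℤ) ^ Fintype.card B * ((-1) ^ I.ncard *
        if supp cs (comp cs I v) = J then 1 else 0) := by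
    intro v
    calc _ = ∑ u : W, if supp cs u = J then (if supp cs v = Set.univ then μβ u v else 0) else 0 := by
          refine Finset.sum_congr rfl fun u _ => ?_
          by_cases huv : bhzLE cs u v
          · simp only [huv, true_and]
            split_ifs <;> tauto
          · simp [huv, hβ0 u v huv]
      _ = ∑ u : W, ∑ I : Set B, if comp cs I v = u then (if supp cs u = J then
            (-1 : ℤ) ^ Fintype.card B * (-1) ^ I.ncard else 0) else 0 := by
          refine Finset.sum_congr rfl fun u _ => ?_
          rw [mobius_bhz_eq_sum cs μβ hβ0 hβ1]
          by_cases hu : supp cs u = J <;> simp [hu]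
      _ = _ := by
          rw [Finset.sum_comm]
          refine Finset.sum_congr rfl fun I _ => ?_
          rw [Finset.sum_ite_eq, if_pos (Finset.mem_univ _)]
          split_ifs <;> ring
  simp_rw [h1]
  rw [Finset.sum_comm, Finset.mul_sum]
  refine Finset.sum_congr rfl fun I _ => ?_
  rw [natCard_subtype_eq_sum, ← Finset.mul_sum, ← Finset.mul_sum]
  congr!

/-- For every `J ⊆ S`:
`Σ_{v, D_R(v) = J} μ_σ(e,v) = (−1)^n · Σ_{u ≤_β v, S(v) = S, S(u) = J} μ_β(u,v)`.
Here `μσ` and `μβ` are the Möbius functions of the posets `(W, ≤_σ)` and `(W, ≤_β)`,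
characterized by their defining recurrences. -/
theorem mobius_sums_eq [Finite W] [Fintype W] [Fintype B] (μσ : W → W → ℤ)
    (hσ0 : ∀ u v : W, ¬ shardLE cs u v → μσ u v = 0)
    (hσ1 : ∀ u v : W, shardLE cs u v →
      (∑ w : W, if shardLE cs u w ∧ shardLE cs w v then μσ u w else 0) =
        if u = v then 1 else 0)
    (μβ : W → W → ℤ)
    (hβ0 : ∀ u v : W, ¬ bhzLE cs u v → μβ u v = 0)
    (hβ1 : ∀ u v : W, bhzLE cs u v →
      (∑ w : W, if bhzLE cs u w ∧ bhzLE cs w v then μβ u w else 0) =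
        if u = v then 1 else 0)
    (J : Set B) :
    (∑ v : W, if {i : B | cs.IsRightDescent v i} = J then μσ 1 v else 0) =
      (-1 : ℤ) ^ (Fintype.card B) *
        ∑ v : W, ∑ u : W,
          if bhzLE cs u v ∧ supp cs v = (Set.univ : Set B) ∧ supp cs u = J then
            μβ u v else 0 := by
  have hL : ∀ v : W, (if {i : B | cs.IsRightDescent v i} = J then μσ 1 v else 0) =
      altParabSum cs J * if {i : B | cs.IsRightDescent v i} = J then 1 else 0 := by
    intro v
    by_cases h : {i : B | cs.IsRightDescent v i} = J
    · rw [if_pos h, if_pos h, mobius_shard_eq_altParabSum cs μσ hσ1, h, mul_one]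
    · rw [if_neg h, if_neg h, mul_zero]
  have hR : ∀ I : Set B, (-1 : ℤ) ^ I.ncard * Nat.card {v : W // supp cs (comp cs I v) = J} =
      (if J ⊆ I then (-1 : ℤ) ^ I.ncard *
        (Nat.card {x : W // I ⊆ {i | cs.IsRightDescent x i}} : ℤ) else 0) *
        (Nat.card {u : W // supp cs u = J} : ℤ) := by
    intro I
    rw [card_supp_comp]
    split_ifs <;> simp [mul_assoc]
  have hsq : (-1 : ℤ) ^ Fintype.card B * (-1) ^ Fintype.card B = 1 := by
    rw [← mul_pow]; simp
  rw [sum_mobius_bhz cs μβ hβ0 hβ1, ← mul_assoc, hsq, one_mul]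
  simp_rw [hL, hR]
  rw [← Finset.mul_sum, ← Finset.sum_mul, sum_sign_card_descents, altParabSum_eq]
  ring

end ShardBHZ
end

section
/- Let (W,S) be a finite Coxeter system and let e = u₁ <_β u₂ <_β … <_β u_k be a strict k-chain in the BHZ order on W starting at the identity e. Setting w_i = u_k · u_i⁻¹ for 1 ≤ i ≤ k, one has w₁ >_R w₂ >_R … >_R w_k in the right weak order on W. -/
open scoped Classical

namespace ShardBHZ

variable {B : Type*} {W : Type*} [Group W] {M : CoxeterMatrix B} (cs : CoxeterSystem M W)

/-- The right weak order: `x ≤_R y` iff `ℓ(x) + ℓ(x⁻¹ y) = ℓ(y)`. -/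
def rweakLE (x y : W) : Prop := cs.length x + cs.length (x⁻¹ * y) = cs.length y

/-- If lengths add in the factorizations of `u'` and `v` with right factor `u`, and of `v` with
right factor `u'`, then `v * u'⁻¹ ≤_R v * u⁻¹`. -/
theorem rweakLE_mul_inv_of_length_add {u u' v : W}
    (huu' : cs.length u' = cs.length (u' * u⁻¹) + cs.length u)
    (hu : cs.length v = cs.length (v * u⁻¹) + cs.length u)
    (hu' : cs.length v = cs.length (v * u'⁻¹) + cs.length u') :
    rweakLE cs (v * u'⁻¹) (v * u⁻¹) := by
  have h : (v * u'⁻¹)⁻¹ * (v * u⁻¹) = u' * u⁻¹ := by group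
  rw [rweakLE, h]
  omega

/-- If `e = u₁ <_β ⋯ <_β u_k` is a strict chain in the BHZ order starting at the
identity and `w_i = u_k * u_i⁻¹`, then `w₁ >_R w₂ >_R ⋯ >_R w_k` in the right weak
order. -/
theorem strict_bhz_chain_to_rweak [Finite W] (k : ℕ) (hk : 1 ≤ k) (u : Fin k → W)
    (h1 : u ⟨0, by omega⟩ = 1)
    (hc : ∀ i j : Fin k, i < j → bhzLE cs (u i) (u j) ∧ u i ≠ u j) :
    ∀ i j : Fin k, i < j →
      rweakLE cs (u ⟨k - 1, by omega⟩ * (u j)⁻¹) (u ⟨k - 1, by omega⟩ * (u i)⁻¹) ∧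
        u ⟨k - 1, by omega⟩ * (u j)⁻¹ ≠ u ⟨k - 1, by omega⟩ * (u i)⁻¹ := by
  have hlen : ∀ i j : Fin k, i ≤ j →
      cs.length (u j) = cs.length (u j * (u i)⁻¹) + cs.length (u i) := by
    intro i j hij
    rcases hij.eq_or_lt with rfl | hlt
    · simp
    · exact (hc i j hlt).1.2.2
  have hlast : ∀ i : Fin k, i ≤ ⟨k - 1, by omega⟩ := fun i => Fin.le_def.2 (by grind)
  intro i j hij
  refine ⟨rweakLE_mul_inv_of_length_add cs (hlen i j hij.le) (hlen i _ (hlast i))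
    (hlen j _ (hlast j)), fun h => (hc i j hij).2 ?_⟩
  exact (inv_injective (mul_left_cancel h)).symm

end ShardBHZ
end

section
/- Let (W,S) be a finite Coxeter system. The map φ sending a strict k-chain e = u₁ <_β u₂ <_β … <_β u_k in the BHZ order on W starting at the identity to the subset {u_k · u_i⁻¹ : 1 ≤ i ≤ k} of W is injective: if two strict chains in the BHZ order, each starting at e, have the same image under φ, then they are equal (in particular they have the same length). -/
open scoped Classical

namespace ShardBHZ

variable {B : Type*} {W : Type*} [Group W] {M : CoxeterMatrix B} (cs : CoxeterSystem M W)

theorem length_lt_of_bhzLE {u v : W} (h : bhzLE cs u v) (hne : u ≠ v) :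
    cs.length u < cs.length v := by
  have hpos : cs.length (v * u⁻¹) ≠ 0 := fun h0 =>
    hne (mul_inv_eq_one.mp (cs.length_eq_zero_iff.mp h0)).symm
  have := h.2.2
  omega

theorem length_mul_inv_add_of_chain {k : ℕ} (u : Fin k → W) (a : Fin k) (ha : ∀ i, i ≤ a)
    (hc : ∀ i j : Fin k, i < j → bhzLE cs (u i) (u j) ∧ u i ≠ u j) (i : Fin k) :
    cs.length (u a) = cs.length (u a * (u i)⁻¹) + cs.length (u i) := by
  rcases (ha i).eq_or_lt with rfl | hi
  · simp
  · exact (hc _ _ hi).1.2.2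

/-- The last term `v` of a chain starting at the identity is the unique longest element of
`{v * u_i⁻¹}`, so it is determined by that set. -/
theorem last_eq_of_range_eq {k k' : ℕ} (u : Fin k → W) (u' : Fin k' → W)
    (a z : Fin k) (a' z' : Fin k') (ha : ∀ i, i ≤ a) (ha' : ∀ i, i ≤ a')
    (h1 : u z = 1) (h1' : u' z' = 1)
    (hc : ∀ i j : Fin k, i < j → bhzLE cs (u i) (u j) ∧ u i ≠ u j)
    (hc' : ∀ i j : Fin k', i < j → bhzLE cs (u' i) (u' j) ∧ u' i ≠ u' j)
    (him : Set.range (fun i => u a * (u i)⁻¹) = Set.range (fun i => u' a' * (u' i)⁻¹)) :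
    u a = u' a' := by
  obtain ⟨i, hi⟩ := him.subset ⟨z, rfl⟩
  obtain ⟨j, hj⟩ := him.superset ⟨z', rfl⟩
  simp only [h1, h1', inv_one, mul_one] at hi hj
  have li := length_mul_inv_add_of_chain cs u' a' ha' hc' i
  have lj := length_mul_inv_add_of_chain cs u a ha hc j
  rw [hi] at li
  rw [hj] at lj
  have h0 : u' i = 1 := cs.length_eq_zero_iff.mp (by omega)
  rw [← hi, h0, inv_one, mul_one]

/-- Two families indexed by initial segments of `ℕ` with the same range agree if a common
statistic is strictly increasing along both. -/
theorem eq_of_range_eq_of_strictMono {α : Type*} (f : α → ℕ) {k k' : ℕ}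
    (u : Fin k → α) (u' : Fin k' → α) (hu : StrictMono (f ∘ u)) (hu' : StrictMono (f ∘ u'))
    (hr : Set.range u = Set.range u') :
    ∃ h : k = k', ∀ i : Fin k, u i = u' (Fin.cast h i) := by
  have hk : k = k' := by
    have h := congrArg Set.ncard hr
    rwa [Set.ncard_range_of_injective hu.injective.of_comp,
      Set.ncard_range_of_injective hu'.injective.of_comp, Nat.card_fin, Nat.card_fin] at h
  subst hk
  refine ⟨rfl, fun i => ?_⟩
  have hf : f ∘ u = f ∘ u' := (hu.range_inj hu').mp (by rw [Set.range_comp, Set.range_comp, hr])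
  obtain ⟨j, hj⟩ := hr.subset ⟨i, rfl⟩
  have hij : i = j := hu'.injective ((congrFun hf i).symm.trans (congrArg f hj.symm))
  rw [← hj, hij]
  rfl

/-- The map sending a strict chain `e = u₁ <_β ⋯ <_β u_k` starting at the identity to
the set `{u_k * u_i⁻¹ : 1 ≤ i ≤ k}` is injective: two such chains with the same image
are equal (in particular they have the same length). -/
theorem phi_injective [Finite W] (k k' : ℕ) (hk : 1 ≤ k) (hk' : 1 ≤ k')
    (u : Fin k → W) (u' : Fin k' → W)
    (h1 : u ⟨0, by omega⟩ = 1) (h1' : u' ⟨0, by omega⟩ = 1)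
    (hc : ∀ i j : Fin k, i < j → bhzLE cs (u i) (u j) ∧ u i ≠ u j)
    (hc' : ∀ i j : Fin k', i < j → bhzLE cs (u' i) (u' j) ∧ u' i ≠ u' j)
    (him : Set.range (fun i : Fin k => u ⟨k - 1, by omega⟩ * (u i)⁻¹) =
        Set.range (fun i : Fin k' => u' ⟨k' - 1, by omega⟩ * (u' i)⁻¹)) :
    ∃ h : k = k', ∀ i : Fin k, u i = u' (Fin.cast h i) := by
  have hlast := last_eq_of_range_eq cs u u' _ _ _ _
    (fun i => Nat.le_sub_one_of_lt i.isLt) (fun i => Nat.le_sub_one_of_lt i.isLt)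
    h1 h1' hc hc' him
  refine eq_of_range_eq_of_strictMono cs.length u u'
    (fun i j hij => length_lt_of_bhzLE cs (hc i j hij).1 (hc i j hij).2)
    (fun i j hij => length_lt_of_bhzLE cs (hc' i j hij).1 (hc' i j hij).2) ?_
  rw [hlast] at him
  refine Set.Subset.antisymm ?_ ?_
  · rintro _ ⟨i, rfl⟩
    obtain ⟨j, hj⟩ := him.subset ⟨i, rfl⟩
    exact ⟨j, inv_injective (mul_left_cancel hj)⟩
  · rintro _ ⟨i, rfl⟩
    obtain ⟨j, hj⟩ := him.superset ⟨i, rfl⟩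
    exact ⟨j, inv_injective (mul_left_cancel hj)⟩

end ShardBHZ
end
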